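/- arXiv:2404.11123 — 2 statements merged into one kernel-verified Lean document; each statement's English description precedes it below -/
import Mathlib

section
/- Let X ⊆ 𝔸^n be an affine variety over a finite field 𝔽_q of dimension r and degree δ. Then the number of 𝔽_q-rational points of X is at most δ·q^r. -/
open scoped Classical NNReal
open Polynomial MeasureTheory

noncomputable section

/-! ## The field `K∞ = 𝔽_q((1/t))`, modelled as formal Laurent series in `τ = t⁻¹` -/

/-- `t`, as an element of `K∞ = 𝔽_q((τ))` with `τ = t⁻¹`: the Laurent series `single (-1) 1`. -/
def tK (Fq : Type) [Field Fq] : LaurentSeries Fq := HahnSeries.single (-1 : ℤ) 1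

/-- The canonical embedding of the polynomial ring `𝔽_q[t]` into `K∞`. -/
def polyToK (Fq : Type) [Field Fq] (p : Polynomial Fq) : LaurentSeries Fq :=
  Polynomial.eval₂ HahnSeries.C (tK Fq) p

/-- The absolute value `|α| = q^{ord α}` on `K∞` (with `|0| = 0`). -/
def absK (Fq : Type) [Field Fq] [Fintype Fq] (α : LaurentSeries Fq) : ℝ≥0 :=
  if α = 0 then 0 else (Fintype.card Fq : ℝ≥0) ^ (-(HahnSeries.order α))

/-- Sup-absolute value of a vector. -/
def vabs (Fq : Type) [Field Fq] [Fintype Fq] {R : ℕ} (β : Fin R → LaurentSeries Fq) : ℝ≥0 :=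
  Finset.univ.sup fun k => absK Fq (β k)

/-- `‖α‖`: the distance from `α` to the ring of polynomials `𝔽_q[t]`;
this equals `|{α}|` where `{α}` is the fractional part of `α`. -/
def distP (Fq : Type) [Field Fq] [Fintype Fq] (α : LaurentSeries Fq) : ℝ≥0 :=
  sInf {r : ℝ≥0 | ∃ b : Polynomial Fq, r = absK Fq (α - polyToK Fq b)}

/-- The unit ball `𝕋 = {α ∈ K∞ : |α| < 1}`. -/
def TT (Fq : Type) [Field Fq] [Fintype Fq] : Set (LaurentSeries Fq) := {α | absK Fq α < 1}

/-- The unit polydisc `𝕋^n`. -/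
def TTn (Fq : Type) [Field Fq] [Fintype Fq] (n : ℕ) : Set (Fin n → LaurentSeries Fq) :=
  {v | ∀ i, absK Fq (v i) < 1}

/-- The standard additive character `ψ` of `K∞`:
`ψ(α) = exp(2πi·tr(a₋₁)/p)` where `a₋₁` is the coefficient of `t⁻¹` in `α`. -/
def psiK (Fq : Type) [Field Fq] [Fintype Fq] (p : ℕ) [CharP Fq p] (α : LaurentSeries Fq) : ℂ :=
  letI : Algebra (ZMod p) Fq := (ZMod.castHom dvd_rfl Fq).toAlgebra
  Complex.exp (2 * Real.pi * Complex.I *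
    ((Algebra.trace (ZMod p) Fq (α.coeff 1)).val : ℂ) / (p : ℂ))

/-- The polynomial with coefficient vector `v`; as `v` ranges over `Fin P → Fq` this
parametrises exactly the polynomials of norm `< q^P`, i.e. of degree `< P`. -/
def polyOf (Fq : Type) [Field Fq] {P : ℕ} (v : Fin P → Fq) : Polynomial Fq :=
  ∑ j : Fin P, Polynomial.C (v j) * Polynomial.X ^ (j : ℕ)

/-! ## Zariski-closed sets, irreducibility, dimension and degree -/

/-- A Zariski-closed subset of affine `n`-space. -/
def ZarClosed (F : Type) [Field F] (n : ℕ) (S : Set (Fin n → F)) : Prop :=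
  ∃ T : Set (MvPolynomial (Fin n) F), S = {x | ∀ f ∈ T, MvPolynomial.eval x f = 0}

/-- Irreducibility of a set with respect to the Zariski topology. -/
def IrredSet (F : Type) [Field F] (n : ℕ) (S : Set (Fin n → F)) : Prop :=
  S.Nonempty ∧ ∀ C₁ C₂ : Set (Fin n → F), ZarClosed F n C₁ → ZarClosed F n C₂ →
    S ⊆ C₁ ∪ C₂ → S ⊆ C₁ ∨ S ⊆ C₂

/-- Dimension of a subset of affine space: the length of the longest chain of
irreducible Zariski-closed subsets contained in it. -/
def zdim (F : Type) [Field F] (n : ℕ) (S : Set (Fin n → F)) : ℕ :=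
  sSup {m : ℕ | ∃ c : Fin (m + 1) → Set (Fin n → F),
    (∀ i, ZarClosed F n (c i) ∧ IrredSet F n (c i) ∧ c i ⊆ S) ∧ StrictMono c}

/-- Degree of an (irreducible) affine variety `S`: the largest (finite) number of points in
which an affine-linear subspace of complementary dimension can meet `S`. -/
def zdeg (F : Type) [Field F] (n : ℕ) (S : Set (Fin n → F)) : ℕ :=
  sSup {m : ℕ | ∃ L : AffineSubspace F (Fin n → F),
    Module.finrank F L.direction = n - zdim F n S ∧
    (S ∩ (L : Set (Fin n → F))).Finite ∧ (S ∩ (L : Set (Fin n → F))).ncard = m}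

/-! ## Smooth complete intersections and counting functions -/

/-- `f₁, …, f_R` are forms of degree `d` cutting out a smooth complete intersection
of codimension `R` in `ℙ^{n-1}`: they are homogeneous of degree `d`, the affine cone has
dimension `n - R`, and the Jacobian matrix has full rank `R` at every nonzero point of the
cone over the algebraic closure. -/
def SmoothCI (Fq : Type) [Field Fq] {n R : ℕ} (d : ℕ)
    (f : Fin R → MvPolynomial (Fin n) Fq) : Prop :=
  (∀ k, (f k).IsHomogeneous d) ∧
  zdim (AlgebraicClosure Fq) n
      {x : Fin n → AlgebraicClosure Fq | ∀ k, MvPolynomial.aeval x (f k) = 0} = n - R ∧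
  ∀ x : Fin n → AlgebraicClosure Fq, x ≠ 0 → (∀ k, MvPolynomial.aeval x (f k) = 0) →
    Matrix.rank (Matrix.of fun (k : Fin R) (i : Fin n) =>
      MvPolynomial.aeval x (MvPolynomial.pderiv i (f k))) = R

/-- The number of `z ∈ 𝔽_q[t]^n` with `|z| < q^D`, satisfying the side condition `extra`,
and with `f_k(z) ≡ 0 (mod g)` for all `k`. -/
def NsolP (Fq : Type) [Field Fq] {n R : ℕ} (f : Fin R → MvPolynomial (Fin n) Fq)
    (g : Polynomial Fq) (D : ℕ) (extra : (Fin n → Polynomial Fq) → Prop) : ℕ :=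
  Nat.card {z : Fin n → Polynomial Fq //
    (∀ i, (z i).degree < (D : WithBot ℕ)) ∧ extra z ∧
    ∀ k, g ∣ MvPolynomial.aeval z (f k)}

/-! ## Exponential sums -/

/-- The exponential sum `S(α; P) = Σ_{|x| < q^P} ψ(α · f(mx + b))`. -/
def Ssum (Fq : Type) [Field Fq] [Fintype Fq] (p : ℕ) [CharP Fq p] {n R : ℕ}
    (f : Fin R → MvPolynomial (Fin n) Fq) (m : Polynomial Fq) (b : Fin n → Polynomial Fq)
    (α : Fin R → LaurentSeries Fq) (P : ℕ) : ℂ :=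
  ∑ x : Fin n → Fin P → Fq,
    psiK Fq p (∑ k, α k *
      polyToK Fq (MvPolynomial.aeval (fun i => m * polyOf Fq (x i) + b i) (f k)))

/-- The complete exponential sum `S_g(a) = |g|^{-n} Σ_{|y| < |g|} ψ(a · f(my + b) / g)`. -/
def SgSum (Fq : Type) [Field Fq] [Fintype Fq] (p : ℕ) [CharP Fq p] {n R : ℕ}
    (f : Fin R → MvPolynomial (Fin n) Fq) (m : Polynomial Fq) (b : Fin n → Polynomial Fq)
    (g : Polynomial Fq) (a : Fin R → Polynomial Fq) : ℂ :=
  ((Fintype.card Fq : ℂ) ^ (g.natDegree * n))⁻¹ *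
    ∑ y : Fin n → Fin g.natDegree → Fq,
      psiK Fq p (∑ k, polyToK Fq (a k) *
        polyToK Fq (MvPolynomial.aeval (fun i => m * polyOf Fq (y i) + b i) (f k)) /
        polyToK Fq g)

/-! ## Forms given by symmetric coefficients, and their multilinear forms -/

/-- Symmetry of a system of degree-`d` coefficients. -/
def SymCoeffs (Fq : Type) [Field Fq] (d n : ℕ) (c : (Fin d → Fin n) → Fq) : Prop :=
  ∀ (σ : Equiv.Perm (Fin d)) (s : Fin d → Fin n), c (s ∘ σ) = c s

/-- Evaluation of the degree-`d` form with coefficients `c`: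
`f(x) = Σ_{i₁,…,i_d} c_{i₁…i_d} x_{i₁} ⋯ x_{i_d}`. -/
def formEval (Fq : Type) [Field Fq] {A : Type} [CommRing A] (d n : ℕ) (φ : Fq →+* A)
    (c : (Fin d → Fin n) → Fq) (x : Fin n → A) : A :=
  ∑ s : Fin d → Fin n, φ (c s) * ∏ j, x (s j)

/-- The `i`-th multilinear form of the form with symmetric coefficients `c`:
`Ψ_i(x^{(1)},…,x^{(d-1)}) = d! Σ c_{i₁…i_{d-1} i} x^{(1)}_{i₁} ⋯ x^{(d-1)}_{i_{d-1}}`. -/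
def psiML (Fq : Type) [Field Fq] {A : Type} [CommRing A] (d n : ℕ) (φ : Fq →+* A)
    (c : (Fin d → Fin n) → Fq) (i : Fin n) (u : Fin (d - 1) → Fin n → A) : A :=
  (Nat.factorial d : A) * ∑ idx : Fin (d - 1) → Fin n,
    φ (c fun j => if h : (j : ℕ) < d - 1 then idx ⟨(j : ℕ), h⟩ else i) * ∏ j, u j (idx j)

/-- The exponential sum `S(α; P)` for the system of forms with coefficients `c`. -/
def SsumC (Fq : Type) [Field Fq] [Fintype Fq] (p : ℕ) [CharP Fq p] (d n R : ℕ)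
    (c : Fin R → (Fin d → Fin n) → Fq) (m : Polynomial Fq) (b : Fin n → Polynomial Fq)
    (α : Fin R → LaurentSeries Fq) (P : ℕ) : ℂ :=
  ∑ x : Fin n → Fin P → Fq,
    psiK Fq p (∑ k, α k * polyToK Fq
      (formEval Fq d n Polynomial.C (c k) fun i => m * polyOf Fq (x i) + b i))

/-! ## The field `F = algebraic closure of 𝔽_q(t)` and the Birch singular loci -/

/-- An algebraically closed field containing `𝔽_q[t]`. -/
abbrev FF (Fq : Type) [Field Fq] : Type := AlgebraicClosure (FractionRing (Polynomial Fq))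

/-- The embedding `𝔽_q[t] → F`. -/
def embPoly (Fq : Type) [Field Fq] : Polynomial Fq →+* FF Fq :=
  (algebraMap (FractionRing (Polynomial Fq)) (FF Fq)).comp
    (algebraMap (Polynomial Fq) (FractionRing (Polynomial Fq)))

/-- The embedding `𝔽_q → F`. -/
def embFq (Fq : Type) [Field Fq] : Fq →+* FF Fq := (embPoly Fq).comp Polynomial.C

/-- `σ_f`: the maximum over nonzero `h ∈ 𝔽_q[t]^R` of the dimension of the locus
`V_{h·f} = {x : h₁∇f₁(x) + ⋯ + h_R ∇f_R(x) = 0}`. -/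
def sigmaF (Fq : Type) [Field Fq] {n R : ℕ} (f : Fin R → MvPolynomial (Fin n) Fq) : ℕ :=
  sSup {s : ℕ | ∃ h : Fin R → Polynomial Fq, h ≠ 0 ∧
    s = zdim (FF Fq) n {x : Fin n → FF Fq | ∀ i : Fin n,
      ∑ k, embPoly Fq (h k) *
        MvPolynomial.eval₂ (embFq Fq) x (MvPolynomial.pderiv i (f k)) = 0}}

namespace PtBound

section Noether

variable {K L : Type} [Field K] [Field L] [Algebra K L]

/-- coefficients criterion for a derivative being nonzero, minimal relations -/
lemma exists_pderiv_ne_zero [PerfectField K] (p : ℕ) [Fact p.Prime] [CharP K p] {n : ℕ}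
    (x : Fin n → L) (F : MvPolynomial (Fin n) K) (hF0 : F ≠ 0) (hF : MvPolynomial.aeval x F = 0)
    (hmin : ∀ G : MvPolynomial (Fin n) K, G ≠ 0 → MvPolynomial.aeval x G = 0 →
      F.totalDegree ≤ G.totalDegree) :
    ∃ i, MvPolynomial.aeval x (MvPolynomial.pderiv i F) ≠ 0 := by
  have hp : p.Prime := Fact.out
  have : ExpChar K p := .prime hp
  have : CharP L p := .of_ringHom_of_ne_zero (algebraMap K L) p hp.ne_zero
  obtain ⟨i, σ, hσ, hdvd⟩ := MvPolynomial.exists_mem_support_not_dvd_of_forall_totalDegree_le p hp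
    (k := K) (K := L) (a := x) (F := F) (fun s hs => by
      refine hs.map_of_injective_injective (frobeniusEquiv K p).symm
        (frobenius L p).toAddMonoidHom (by simp) (by simp) (fun r m => ?_)
      change (((frobeniusEquiv K p).symm r) • m) ^ p = r • m ^ p
      rw [Algebra.smul_def, mul_pow, ← map_pow, ← frobenius_def, frobenius_apply_frobeniusEquiv_symm, Algebra.smul_def])
    hmin hF0 hF
  refine ⟨i, fun h0 => ?_⟩
  have hσi : σ i ≠ 0 := by rintro h; rw [h] at hdvd; exact hdvd (dvd_zero p)
  have hne : MvPolynomial.pderiv i F ≠ 0 := by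
    intro h
    have := congrArg (MvPolynomial.coeff (σ - Finsupp.single i 1)) h
    rw [MvPolynomial.coeff_pderiv, MvPolynomial.coeff_zero] at this
    have e : σ - Finsupp.single i 1 + Finsupp.single i 1 = σ := by
      ext j
      by_cases hj : j = i
      · subst hj; simp; omega
      · simp [Ne.symm hj]
    rw [e] at this
    rcases mul_eq_zero.1 this with h | h
    · exact (MvPolynomial.mem_support_iff.1 hσ) h
    · apply hdvd
      rw [← CharP.cast_eq_zero_iff K p]
      have h2 : ((((σ - Finsupp.single i 1 : Fin n →₀ ℕ) i + 1 : ℕ)) : K) = 0 := by exact_mod_cast h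
      have h3 : (σ - Finsupp.single i 1 : Fin n →₀ ℕ) i + 1 = σ i := by simp; omega
      rwa [h3] at h2
  have hle := hmin _ hne h0
  have hlt : (MvPolynomial.pderiv i F).totalDegree < F.totalDegree := by
    have hpos : 0 < F.totalDegree := by
      have := MvPolynomial.le_totalDegree hσ
      have h1 : σ i ≤ σ.sum fun _ e => e := by
        rw [Finsupp.sum]
        exact Finset.single_le_sum (f := fun j => σ j) (fun _ _ => Nat.zero_le _)
          (Finsupp.mem_support_iff.2 hσi)
      omega
    rw [MvPolynomial.totalDegree, Finset.sup_lt_iff (by simpa using hpos)]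
    intro τ hτ
    have h1 : F.coeff (τ + Finsupp.single i 1) ≠ 0 := by
      rw [MvPolynomial.mem_support_iff, MvPolynomial.coeff_pderiv] at hτ
      exact left_ne_zero_of_mul hτ
    have h2 := MvPolynomial.le_totalDegree (MvPolynomial.mem_support_iff.2 h1)
    rw [Finsupp.sum_add_index' (by simp) (by simp)] at h2
    simp at h2
    change (τ.sum fun _ e => e) < _
    omega
  omega

/-- The submodule `K + ⟨x₁, …, xₙ⟩`. -/
def WW {A : Type} [CommRing A] [Algebra K A] {n : ℕ} (x : Fin n → A) : Submodule K A :=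
  1 ⊔ Submodule.span K (Set.range x)

/-- `U` is a reduction of `W`. -/
def IsRed {A : Type} [CommRing A] [Algebra K A] (U W : Submodule K A) : Prop :=
  1 ≤ U ∧ U ≤ W ∧ ∃ c : ℕ, W ^ (c + 1) ≤ U * W ^ c

lemma IsRed.trans {A : Type} [CommRing A] [Algebra K A] {U V W : Submodule K A}
    (h1 : IsRed U V) (h2 : IsRed V W) : IsRed U W := by
  obtain ⟨a1, a2, a, ha⟩ := h1
  obtain ⟨b1, b2, b, hb⟩ := h2
  refine ⟨a1, a2.trans b2, a + b, ?_⟩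
  have key : ∀ k, W ^ (b + k) ≤ V ^ k * W ^ b := by
    intro k
    induction k with
    | zero => simp
    | succ k ih =>
      calc W ^ (b + (k + 1)) = W ^ (b + k) * W := by rw [← add_assoc, pow_succ]
        _ ≤ V ^ k * W ^ b * W := by gcongr
        _ = V ^ k * W ^ (b + 1) := by rw [mul_assoc, pow_succ]
        _ ≤ V ^ k * (V * W ^ b) := by gcongr
        _ = V ^ (k + 1) * W ^ b := by rw [← mul_assoc, pow_succ]
  calc W ^ (a + b + 1) = W ^ (b + (a + 1)) := by congr 1; omega
    _ ≤ V ^ (a + 1) * W ^ b := key _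
    _ ≤ U * V ^ a * W ^ b := by gcongr
    _ ≤ U * W ^ a * W ^ b := by gcongr
    _ = U * W ^ (a + b) := by rw [mul_assoc, pow_add]

lemma one_le_WW {A : Type} [CommRing A] [Algebra K A] {n : ℕ} (x : Fin n → A) :
    (1 : Submodule K A) ≤ WW x := le_sup_left

lemma mem_WW {A : Type} [CommRing A] [Algebra K A] {n : ℕ} (x : Fin n → A) (i : Fin n) :
    x i ∈ WW (K := K) x := (le_sup_right : _ ≤ WW (K := K) x) (Submodule.subset_span ⟨i, rfl⟩)

lemma IsRed.refl {A : Type} [CommRing A] [Algebra K A] {W : Submodule K A} (h : 1 ≤ W) :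
    IsRed W W := ⟨h, le_rfl, 0, by simp⟩

end Noether
end PtBound

namespace PtBound

section Step

variable {K A : Type} [Field K] [CommRing A] [Algebra K A]

lemma pow_le_pow_of_one_le {W : Submodule K A} (h : 1 ≤ W) {a b : ℕ} (hab : a ≤ b) :
    W ^ a ≤ W ^ b := pow_le_pow_right₀ h hab

lemma prod_mem_pow {n : ℕ} (x : Fin n → A) (W : Submodule K A) (hx : ∀ i, x i ∈ W)
    (s : Multiset (Fin n)) : (s.map x).prod ∈ W ^ (Multiset.card s) := by
  induction s using Multiset.induction with
  | empty => simpa using ⟨1, map_one _⟩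
  | cons a s ih =>
    rw [Multiset.map_cons, Multiset.prod_cons, Multiset.card_cons, pow_succ']
    exact Submodule.mul_mem_mul (hx a) ih

lemma prod_sub_mem {n : ℕ} (x : Fin n → A) (v : Fin n → K) (t : A) (W' W : Submodule K A)
    (hx : ∀ i, x i ∈ W) (ht : t ∈ W) (hd : ∀ i, x i - v i • t ∈ W')
    (s : Multiset (Fin n)) : (s = 0 ∧ (s.map x).prod - (s.map v).prod • t ^ (Multiset.card s) = 0) ∨
      ∃ k, Multiset.card s = k + 1 ∧
      (s.map x).prod - (s.map v).prod • t ^ (k + 1) ∈ W' * W ^ k := by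
  induction s using Multiset.induction with
  | empty => left; simp
  | cons a s ih =>
    right
    refine ⟨Multiset.card s, by simp, ?_⟩
    have key : ((a ::ₘ s).map x).prod - ((a ::ₘ s).map v).prod • t ^ (Multiset.card s + 1)
        = (x a - v a • t) * (s.map x).prod +
          v a • (t * ((s.map x).prod - (s.map v).prod • t ^ (Multiset.card s))) := by
      simp only [Multiset.map_cons, Multiset.prod_cons, Algebra.smul_def, map_mul, pow_succ]
      ring
    rw [key]
    refine add_mem (Submodule.mul_mem_mul (hd a) (prod_mem_pow x W hx s)) (Submodule.smul_mem _ _ ?_)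
    rcases ih with ⟨h1, h2⟩ | ⟨k, h1, h2⟩
    · rw [h2]; simp
    · rw [h1, pow_succ', ← mul_assoc, mul_comm W' W, mul_assoc]
      exact Submodule.mul_mem_mul ht h2

lemma monomial_aeval {n : ℕ} (x : Fin n → A) (α : Fin n →₀ ℕ) (c : K) :
    MvPolynomial.aeval x (MvPolynomial.monomial α c) =
      c • ((Finsupp.toMultiset α).map x).prod := by
  rw [MvPolynomial.aeval_monomial, Algebra.smul_def, Finsupp.toMultiset_map, Finsupp.prod_toMultiset]
  congr 1
  rw [Finsupp.prod_mapDomain_index (by simp) (by intros; rw [pow_add])]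

lemma pow_mem_of_rel {n : ℕ} (x : Fin n → A) (v : Fin n → K) (t : A) (W' W : Submodule K A)
    (h1 : 1 ≤ W') (hW : W' ≤ W)
    (hx : ∀ i, x i ∈ W) (ht : t ∈ W) (hd : ∀ i, x i - v i • t ∈ W')
    (f : MvPolynomial (Fin n) K) (D : ℕ) (hD : f.totalDegree = D + 1)
    (hf : MvPolynomial.aeval x f = 0)
    (hv : MvPolynomial.eval v (MvPolynomial.homogeneousComponent (D + 1) f) ≠ 0) :
    t ^ (D + 1) ∈ W' * W ^ D := by
  have h1W : 1 ≤ W := h1.trans hW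
  have key : MvPolynomial.aeval x f -
      (MvPolynomial.eval v (MvPolynomial.homogeneousComponent (D + 1) f)) • t ^ (D + 1)
      ∈ W' * W ^ D := by
    have e1 : MvPolynomial.aeval x f = ∑ α ∈ f.support,
        f.coeff α • ((Finsupp.toMultiset α).map x).prod := by
      conv_lhs => rw [f.as_sum]
      rw [map_sum]
      exact Finset.sum_congr rfl fun α _ => monomial_aeval _ _ _
    have e2 : MvPolynomial.eval v (MvPolynomial.homogeneousComponent (D + 1) f) =
        ∑ α ∈ f.support, if α.degree = D + 1 then
          f.coeff α • ((Finsupp.toMultiset α).map v).prod else 0 := by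
      rw [MvPolynomial.homogeneousComponent_apply, map_sum, Finset.sum_filter]
      refine Finset.sum_congr rfl fun α _ => ?_
      split_ifs
      · rw [← monomial_aeval]; simp [MvPolynomial.aeval_eq_eval]
      · rfl
    rw [e1, e2, Finset.sum_smul, ← Finset.sum_sub_distrib]
    refine Submodule.sum_mem _ fun α hα => ?_
    have hcard : Multiset.card (Finsupp.toMultiset α) = α.degree := by
      rw [Finsupp.card_toMultiset]; rfl
    split_ifs with hdeg
    · rw [smul_assoc, ← smul_sub]
      refine Submodule.smul_mem _ _ ?_
      rcases prod_sub_mem x v t W' W hx ht hd (Finsupp.toMultiset α) with ⟨h, _⟩ | ⟨k, h2, h3⟩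
      · rw [h] at hcard; simp at hcard; omega
      · obtain rfl : k = D := by omega
        exact h3
    · rw [zero_smul, sub_zero]
      refine Submodule.smul_mem _ _ ?_
      have hle : α.degree ≤ D + 1 := by
        rw [← hD]; exact MvPolynomial.le_totalDegree hα
      have h2 := prod_mem_pow x W hx (Finsupp.toMultiset α)
      rw [hcard] at h2
      have h3 : W ^ D ≤ W' * W ^ D := by
        calc W ^ D = 1 * W ^ D := (one_mul _).symm
          _ ≤ _ := by gcongr
      exact h3 (pow_le_pow_of_one_le h1W (by omega) h2)
  rw [hf, zero_sub, neg_mem_iff] at key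
  exact (Submodule.smul_mem_iff _ hv).1 key

lemma pow_le_aux (t : A) (W' W : Submodule K A) (ht : t ∈ W)
    (hW2 : W ≤ W' ⊔ Submodule.span K {t}) (k : ℕ) :
    W ^ (k + 1) ≤ W' * W ^ k ⊔ Submodule.span K {t ^ (k + 1)} := by
  induction k with
  | zero => simpa using hW2
  | succ k ih =>
    calc W ^ (k + 1 + 1) = W * W ^ (k + 1) := by rw [pow_succ']
      _ ≤ (W' ⊔ Submodule.span K {t}) * W ^ (k + 1) := by gcongr
      _ = W' * W ^ (k + 1) ⊔ Submodule.span K {t} * W ^ (k + 1) := Submodule.sup_mul _ _ _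
      _ ≤ W' * W ^ (k + 1) ⊔ Submodule.span K {t} *
          (W' * W ^ k ⊔ Submodule.span K {t ^ (k + 1)}) := by gcongr
      _ = W' * W ^ (k + 1) ⊔ (W' * (Submodule.span K {t} * W ^ k) ⊔
          Submodule.span K {t ^ (k + 1 + 1)}) := by
        rw [Submodule.mul_sup, Submodule.span_mul_span, Set.singleton_mul_singleton, ← pow_succ',
          mul_left_comm]
      _ ≤ W' * W ^ (k + 1) ⊔ (W' * (W * W ^ k) ⊔
          Submodule.span K {t ^ (k + 1 + 1)}) := by
        gcongr
        simpa using ht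
      _ = _ := by rw [← pow_succ', ← sup_assoc, sup_idem]

lemma isRed_of_rel {n : ℕ} (x : Fin n → A) (v : Fin n → K) (t : A) (W' W : Submodule K A)
    (h1 : 1 ≤ W') (hW : W' ≤ W) (hW2 : W ≤ W' ⊔ Submodule.span K {t})
    (hx : ∀ i, x i ∈ W) (ht : t ∈ W) (hd : ∀ i, x i - v i • t ∈ W')
    (f : MvPolynomial (Fin n) K) (D : ℕ) (hD : f.totalDegree = D + 1)
    (hf : MvPolynomial.aeval x f = 0)
    (hv : MvPolynomial.eval v (MvPolynomial.homogeneousComponent (D + 1) f) ≠ 0) :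
    IsRed W' W := by
  refine ⟨h1, hW, D, (pow_le_aux t W' W ht hW2 D).trans (sup_le le_rfl ?_)⟩
  rw [Submodule.span_singleton_le_iff_mem]
  exact pow_mem_of_rel x v t W' W h1 hW hx ht hd f D hD hf hv

end Step
end PtBound

namespace PtBound

section Step2

lemma derivative_aeval {K E : Type} [Field K] [Field E] [Algebra K E] {n : ℕ}
    (Y : Fin n → E[X]) (f : MvPolynomial (Fin n) K) :
    derivative (MvPolynomial.aeval Y f) =
      ∑ i, MvPolynomial.aeval Y (MvPolynomial.pderiv i f) * derivative (Y i) := by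
  induction f using MvPolynomial.induction_on with
  | C a =>
    simp only [MvPolynomial.algHom_C, MvPolynomial.pderiv_C, map_zero, zero_mul,
      Finset.sum_const_zero]
    rw [IsScalarTower.algebraMap_apply K E E[X]]
    exact derivative_C
  | add p q hp hq => simp only [map_add, hp, hq, add_mul, Finset.sum_add_distrib]
  | mul_X p i hp =>
    simp only [map_mul, MvPolynomial.aeval_X, derivative_mul, hp, MvPolynomial.pderiv_mul, map_add,
      MvPolynomial.pderiv_X, add_mul, Finset.sum_add_distrib]
    congr 1
    · rw [Finset.sum_mul]
      exact Finset.sum_congr rfl fun j _ => by ring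
    · rw [Finset.sum_eq_single i]
      · simp
      · intro j _ hj; simp [Pi.single_apply, hj.symm]
      · simp

lemma isSeparable_of_rel {K E L : Type} [Field K] [Field E] [Field L] [Algebra K E] [Algebra K L]
    [Algebra E L] [IsScalarTower K E L] {n : ℕ} (x : Fin n → L) (z : Fin n → E) (v : Fin n → K)
    (t : L) (hx : ∀ i, x i = algebraMap E L (z i) + v i • t)
    (f : MvPolynomial (Fin n) K) (hf : MvPolynomial.aeval x f = 0)
    (hd : ∑ i, v i • MvPolynomial.aeval x (MvPolynomial.pderiv i f) ≠ 0) : IsSeparable E t := by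
  set Y : Fin n → E[X] := fun i => C (z i) + C (algebraMap K E (v i)) * X with hY
  have hev : ∀ g : MvPolynomial (Fin n) K, aeval t (MvPolynomial.aeval Y g) =
      MvPolynomial.aeval x g := by
    intro g
    have : ((aeval (R := E) t).restrictScalars K).comp (MvPolynomial.aeval Y) =
        MvPolynomial.aeval x := by
      ext i
      simp [hY, hx, Algebra.smul_def, ← IsScalarTower.algebraMap_apply]
    exact DFunLike.congr_fun this g
  set g := MvPolynomial.aeval Y f with hg
  have hg0 : aeval t g = 0 := by rw [hg, hev, hf]
  have hg1 : aeval t (derivative g) ≠ 0 := by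
    rw [hg, derivative_aeval, map_sum]
    simp only [map_mul, hev]
    convert hd using 1
    refine Finset.sum_congr rfl fun i _ => ?_
    simp only [hY, map_add, derivative_C, derivative_mul, zero_mul, derivative_X, mul_one, zero_add, aeval_C]
    rw [Algebra.smul_def, ← IsScalarTower.algebraMap_apply K E L, mul_comm]
  have hgne : g ≠ 0 := by rintro h; rw [h] at hg1; simp at hg1
  have hIntegral : IsIntegral E t := (isAlgebraic_iff_isIntegral).1 ⟨g, hgne, hg0⟩
  have hirr := minpoly.irreducible hIntegral
  rw [_root_.IsSeparable, Polynomial.separable_iff_derivative_ne_zero hirr]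
  intro h0
  obtain ⟨q, hq⟩ := minpoly.dvd E t hg0
  apply hg1
  rw [hq, derivative_mul, h0]
  simp

variable {K L : Type} [Field K] [Field L] [Algebra K L]

lemma noether_step [PerfectField K] [Infinite K] (p : ℕ) [Fact p.Prime] [CharP K p] {n : ℕ}
    (x : Fin (n + 1) → L) (hx : ¬ AlgebraicIndependent K x) :
    ∃ x' : Fin n → L, (∀ i, x' i ∈ Submodule.span K (Set.range x)) ∧ IsRed (K := K) (WW x') (WW x) ∧
      ∀ i, IsSeparable (IntermediateField.adjoin K (Set.range x')) (x i) := by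
  set S := {F : MvPolynomial (Fin (n + 1)) K | F ≠ 0 ∧ MvPolynomial.aeval x F = 0} with hS
  have hSn : S.Nonempty := by
    simpa [S, algebraicIndependent_iff, and_comm, Set.Nonempty] using! hx
  obtain ⟨f, ⟨hf0, hf⟩, hmin⟩ : ∃ F ∈ S, ∀ G : MvPolynomial (Fin (n + 1)) K, G ≠ 0 →
      MvPolynomial.aeval x G = 0 → F.totalDegree ≤ G.totalDegree :=
    ⟨MvPolynomial.totalDegree.argminOn S hSn, MvPolynomial.totalDegree.argminOn_mem ..,
        fun _ h₁ h₂ ↦ MvPolynomial.totalDegree.argminOn_le S ⟨h₁, h₂⟩⟩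
  obtain ⟨i0, hi0⟩ := exists_pderiv_ne_zero p x f hf0 hf hmin
  obtain ⟨D, hD⟩ : ∃ D, f.totalDegree = D + 1 := by
    refine Nat.exists_eq_succ_of_ne_zero fun h => ?_
    rw [MvPolynomial.totalDegree_eq_zero_iff_eq_C] at h
    rw [h] at hf hf0
    simp at hf hf0
    exact hf0 hf
  obtain ⟨φ, hφ⟩ : ∃ φ : Module.Dual K L, φ (MvPolynomial.aeval x (MvPolynomial.pderiv i0 f)) ≠ 0 := by
    by_contra! h
    exact hi0 ((Module.forall_dual_apply_eq_zero_iff K _).1 h)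
  set a : Fin (n + 1) → L := fun i => MvPolynomial.aeval x (MvPolynomial.pderiv i f) with ha
  set ℓ : MvPolynomial (Fin (n + 1)) K := ∑ i, MvPolynomial.C (φ (a i)) * MvPolynomial.X i with hℓ
  have hℓ0 : ℓ ≠ 0 := by
    intro h
    have := congrArg (MvPolynomial.eval (Pi.single i0 1)) h
    simp [hℓ, Pi.single_apply] at this
    exact hφ this
  have hh0 : MvPolynomial.homogeneousComponent (D + 1) f ≠ 0 := by
    obtain ⟨α, hα, hα2⟩ := Finset.exists_mem_eq_sup f.support
      (MvPolynomial.support_nonempty.2 hf0) (fun s => s.sum fun _ e => e)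
    intro h
    have := congrArg (MvPolynomial.coeff α) h
    rw [MvPolynomial.coeff_homogeneousComponent, if_pos] at this
    · exact MvPolynomial.mem_support_iff.1 hα (by simpa using this)
    · rw [← hD]; exact hα2.symm
  obtain ⟨v, hv⟩ : ∃ v, MvPolynomial.eval v (MvPolynomial.homogeneousComponent (D + 1) f * ℓ *
      MvPolynomial.X (Fin.last n)) ≠ 0 := by
    by_contra! h
    have : MvPolynomial.homogeneousComponent (D + 1) f * ℓ * MvPolynomial.X (Fin.last n) = 0 :=
      MvPolynomial.funext fun v => by simpa using h v
    exact mul_ne_zero (mul_ne_zero hh0 hℓ0) (MvPolynomial.X_ne_zero _) this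
  simp only [map_mul, MvPolynomial.eval_X, ne_eq, mul_eq_zero, not_or] at hv
  obtain ⟨⟨hv1, hv2⟩, hv3⟩ := hv
  set t : L := (v (Fin.last n))⁻¹ • x (Fin.last n) with ht
  have hlast : x (Fin.last n) - v (Fin.last n) • t = 0 := by
    rw [ht, smul_smul, mul_inv_cancel₀ hv3, one_smul, sub_self]
  set x' : Fin n → L := fun i => x i.castSucc - v i.castSucc • t with hx'
  have hts : t ∈ Submodule.span K (Set.range x) :=
    Submodule.smul_mem _ _ (Submodule.subset_span ⟨_, rfl⟩)
  have hx's : ∀ i, x' i ∈ Submodule.span K (Set.range x) := fun i =>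
    sub_mem (Submodule.subset_span ⟨_, rfl⟩) (Submodule.smul_mem _ _ hts)
  have hxW : ∀ i, x i - v i • t ∈ WW (K := K) x' := by
    intro i
    induction i using Fin.lastCases with
    | last => rw [hlast]; exact zero_mem _
    | cast i => exact mem_WW x' i
  refine ⟨x', hx's, ?_, ?_⟩
  · refine isRed_of_rel x v t _ _ (one_le_WW _) ?_ ?_ (mem_WW x)
      ((le_sup_right : _ ≤ WW (K := K) x) hts) hxW f D hD hf hv1
    · refine sup_le_sup le_rfl (Submodule.span_le.2 ?_)
      rintro _ ⟨i, rfl⟩; exact hx's i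
    · refine sup_le ((one_le_WW _).trans le_sup_left) (Submodule.span_le.2 ?_)
      rintro _ ⟨i, rfl⟩
      have : x i = (x i - v i • t) + v i • t := by ring
      rw [this]
      exact add_mem (Submodule.mem_sup_left (hxW i)) (Submodule.mem_sup_right
        (Submodule.smul_mem _ _ (Submodule.mem_span_singleton_self t)))
  · set E := IntermediateField.adjoin K (Set.range x') with hE
    have hz : ∀ i, x i - v i • t ∈ E := by
      intro i
      induction i using Fin.lastCases with
      | last => rw [hlast]; exact zero_mem _
      | cast i => exact IntermediateField.subset_adjoin K _ ⟨i, rfl⟩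
    have hsep : IsSeparable E t := by
      refine isSeparable_of_rel x (fun i => ⟨_, hz i⟩) v t (fun i => ?_) f hf ?_
      · change x i = (x i - v i • t) + v i • t
        ring
      · intro h
        apply hv2
        have := congrArg φ h
        simp only [map_sum, map_smul, map_zero, smul_eq_mul] at this
        rw [hℓ, map_sum, ← this]
        refine Finset.sum_congr rfl fun i _ => ?_
        simp [ha, mul_comm]
    intro i
    have h1 : x i = (⟨_, hz i⟩ : E) + (algebraMap K E (v i)) • t := by
      rw [algebraMap_smul]; simp
    rw [h1, ← mem_separableClosure_iff]
    exact add_mem (algebraMap_mem (separableClosure E L) (⟨_, hz i⟩ : E)) (by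
      rw [Algebra.smul_def]
      exact mul_mem (algebraMap_mem _ _) (mem_separableClosure_iff.2 hsep))

theorem noether [PerfectField K] [Infinite K] (p : ℕ) [Fact p.Prime] [CharP K p] {n : ℕ}
    (x : Fin n → L) :
    ∃ (d : ℕ) (y : Fin d → L), AlgebraicIndependent K y ∧
      (∀ i, y i ∈ Submodule.span K (Set.range x)) ∧ IsRed (K := K) (WW y) (WW x) ∧
      ∀ i, IsSeparable (IntermediateField.adjoin K (Set.range y)) (x i) := by
  induction n with
  | zero =>
    refine ⟨0, x, algebraicIndependent_empty_type_iff.2 (algebraMap K L).injective, fun i => i.elim0,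
      IsRed.refl (one_le_WW _), fun i => i.elim0⟩
  | succ n ih =>
    by_cases hx : AlgebraicIndependent K x
    · refine ⟨n + 1, x, hx, fun i => Submodule.subset_span ⟨i, rfl⟩, IsRed.refl (one_le_WW _),
        fun i => ?_⟩
      exact isSeparable_algebraMap (F := IntermediateField.adjoin K (Set.range x))
        (⟨_, IntermediateField.subset_adjoin _ _ ⟨i, rfl⟩⟩ :
          IntermediateField.adjoin K (Set.range x))
    · obtain ⟨x', h1, h2, h3⟩ := noether_step p x hx
      obtain ⟨d, y, a1, a2, a3, a4⟩ := ih x'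
      refine ⟨d, y, a1, fun i => ?_, a3.trans h2, fun i => ?_⟩
      · refine (Submodule.span_le.2 ?_ : Submodule.span K (Set.range x') ≤ _) (a2 i)
        rintro _ ⟨j, rfl⟩; exact h1 j
      · set E := IntermediateField.adjoin K (Set.range y)
        set M := separableClosure E L
        have hle : IntermediateField.adjoin K (Set.range x') ≤ M.restrictScalars K := by
          rw [IntermediateField.adjoin_le_iff]
          rintro _ ⟨j, rfl⟩
          exact mem_separableClosure_iff.2 (a4 j)
        have hs : IsSeparable (M.restrictScalars K) (x i) := by
          let _ := (IntermediateField.inclusion hle).toAlgebra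
          have : IsScalarTower (IntermediateField.adjoin K (Set.range x'))
            (M.restrictScalars K) L := IsScalarTower.of_algebraMap_eq fun _ => rfl
          exact (h3 i).tower_top _
        have hs' : IsSeparable M (x i) := hs
        exact IsSeparable.of_algebra_isSeparable_of_isSeparable E hs'

end Step2
end PtBound

namespace PtBound

section Count

/-- Exponent vectors of total degree at most `m`. -/
def MM (d m : ℕ) : Finset (Fin d → ℕ) :=
  (Fintype.piFinset fun _ : Fin d => Finset.range (m + 1)).filter fun α => ∑ i, α i ≤ m

lemma mem_MM {d m : ℕ} {α : Fin d → ℕ} : α ∈ MM d m ↔ ∑ i, α i ≤ m := by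
  simp only [MM, Finset.mem_filter, Fintype.mem_piFinset, Finset.mem_range, and_iff_right_iff_imp]
  intro h i
  exact Nat.lt_succ_of_le ((Finset.single_le_sum (fun _ _ => Nat.zero_le _)
    (Finset.mem_univ i)).trans h)

lemma card_MM_le (d m : ℕ) : (MM d m).card ≤ (m + 1) ^ d := by
  refine (Finset.card_filter_le _ _).trans ?_
  simp

lemma card_MM_pos (d m : ℕ) : 0 < (MM d m).card :=
  Finset.card_pos.2 ⟨0, mem_MM.2 (by simp)⟩

lemma card_MM_mul (d k a c : ℕ) (ha : 1 ≤ a) :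
    (MM d (a * k + c)).card ≤ a ^ d * (MM d (k + c)).card := by
  have h : (MM d (a * k + c)).card ≤
      ((Fintype.piFinset fun _ : Fin d => Finset.range a) ×ˢ MM d (k + c)).card := by
    refine Finset.card_le_card_of_injOn (fun α => (fun i => α i % a, fun i => α i / a)) ?_ ?_
    · intro α hα
      have hα := mem_MM.1 hα
      simp only [Finset.coe_product, Set.mem_prod, SetLike.mem_coe, Fintype.mem_piFinset,
        Finset.mem_range, mem_MM]
      refine ⟨fun i => Nat.mod_lt _ ha, ?_⟩
      have h1 : a * ∑ i, α i / a ≤ a * (k + c) := by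
        rw [Finset.mul_sum]
        refine (Finset.sum_le_sum fun i _ => Nat.mul_div_le (α i) a).trans (hα.trans ?_)
        nlinarith
      exact Nat.le_of_mul_le_mul_left h1 ha
    · intro α _ β _ h
      simp only [Prod.mk.injEq] at h
      funext i
      rw [← Nat.div_add_mod (α i) a, ← Nat.div_add_mod (β i) a, congrFun h.1 i, congrFun h.2 i]
  refine h.trans ?_
  simp [Finset.card_product]

lemma asym (N e a d c : ℕ) (ha : 1 ≤ a)
    (h : ∀ k, N * (MM d k).card ≤ e * (MM d (a * k + c)).card) : N ≤ e * a ^ d := by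
  by_contra! hN
  set E := e * a ^ d with hE
  have h1 : ∀ k, (E + 1) * (MM d k).card ≤ E * (MM d (k + c)).card := by
    intro k
    calc (E + 1) * (MM d k).card ≤ N * (MM d k).card := Nat.mul_le_mul_right _ hN
      _ ≤ _ := h k
      _ ≤ e * (a ^ d * (MM d (k + c)).card) := Nat.mul_le_mul_left _ (card_MM_mul d k a c ha)
      _ = _ := by rw [hE]; ring
  have hE0 : 0 < E := by
    by_contra! h0
    have : E = 0 := by lia
    have h2 := h1 0
    rw [this] at h2
    have := card_MM_pos d 0
    lia
  have h2 : ∀ j, (E + 1) ^ j ≤ E ^ j * (MM d (j * c)).card := by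
    intro j
    induction j with
    | zero => have := card_MM_pos d (0 * c); simp only [pow_zero, one_mul]; lia
    | succ j ih =>
      calc (E + 1) ^ (j + 1) = (E + 1) * (E + 1) ^ j := by ring
        _ ≤ (E + 1) * (E ^ j * (MM d (j * c)).card) := Nat.mul_le_mul_left _ ih
        _ = E ^ j * ((E + 1) * (MM d (j * c)).card) := by ring
        _ ≤ E ^ j * (E * (MM d (j * c + c)).card) := Nat.mul_le_mul_left _ (h1 _)
        _ = _ := by rw [show (j + 1) * c = j * c + c by ring]; ring
  have hEr : (0 : ℝ) < E := by exact_mod_cast hE0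
  have hr : (1 : ℝ) < ((E : ℝ) + 1) / E := by rw [lt_div_iff₀ hEr]; linarith
  have h3 : ∀ j : ℕ, 1 ≤ j → (1 : ℝ) ≤ ((c : ℝ) + 1) ^ d * ((j : ℝ) ^ d / (((E : ℝ) + 1) / E) ^ j) := by
    intro j hj
    have h4 : ((E : ℝ) + 1) ^ j ≤ (E : ℝ) ^ j * (((c : ℝ) + 1) * j) ^ d := by
      have h5 : (E + 1) ^ j ≤ E ^ j * ((c + 1) * j) ^ d := by
        refine (h2 j).trans (Nat.mul_le_mul_left _ ((card_MM_le _ _).trans ?_))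
        refine Nat.pow_le_pow_left ?_ _
        nlinarith
      exact_mod_cast h5
    rw [mul_pow] at h4
    rw [div_pow, div_div_eq_mul_div, ← mul_div_assoc, le_div_iff₀ (by positivity)]
    nlinarith
  have h6 := (tendsto_pow_const_div_const_pow_of_one_lt d hr).const_mul (((c : ℝ) + 1) ^ d)
  rw [mul_zero] at h6
  have h7 := ge_of_tendsto h6 (Filter.eventually_atTop.2 ⟨1, fun j hj => h3 j hj⟩)
  linarith

end Count

section Hilb

variable {K : Type} [Field K] {A : Type} [CommRing A] [Algebra K A]

lemma WW_pow_le_span {d : ℕ} (y : Fin d → A) (m : ℕ) :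
    (WW (K := K) y) ^ m ≤ Submodule.span K
      ((fun α : Fin d → ℕ => ∏ i, y i ^ α i) '' (MM d m : Set (Fin d → ℕ))) := by
  induction m with
  | zero =>
    rw [pow_zero, Submodule.one_eq_span, Submodule.span_le, Set.singleton_subset_iff]
    exact Submodule.subset_span ⟨0, mem_MM.2 (by simp), by simp⟩
  | succ m ih =>
    have hW : WW (K := K) y = Submodule.span K ({1} ∪ Set.range y) := by
      rw [WW, Submodule.one_eq_span, Submodule.span_union]
    rw [pow_succ]
    refine (mul_le_mul' ih le_rfl).trans ?_
    rw [hW, Submodule.span_mul_span, Submodule.span_le]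
    rintro _ ⟨_, ⟨α, hα, rfl⟩, z, hz, rfl⟩
    have hα := mem_MM.1 hα
    rcases hz with hz | ⟨j, rfl⟩
    · rw [Set.mem_singleton_iff] at hz
      subst hz
      exact Submodule.subset_span ⟨α, mem_MM.2 (by lia), by simp⟩
    · refine Submodule.subset_span ⟨α + Pi.single j 1, mem_MM.2 ?_, ?_⟩
      · simp only [Pi.add_apply, Finset.sum_add_distrib]
        simp [Finset.sum_pi_single']
        lia
      · simp only [Pi.add_apply, pow_add, Finset.prod_mul_distrib]
        congr 1
        rw [Finset.prod_eq_single j]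
        · simp
        · intro i _ hi; simp [hi]
        · simp

lemma fg_WW {n : ℕ} (x : Fin n → A) : (WW (K := K) x).FG := by
  rw [WW, Submodule.one_eq_span]
  exact (Submodule.fg_span (Set.finite_singleton _)).sup (Submodule.fg_span (Set.finite_range _))

instance finite_WW_pow {n : ℕ} (x : Fin n → A) (m : ℕ) :
    Module.Finite K ((WW (K := K) x) ^ m : Submodule K A) :=
  Module.Finite.iff_fg.2 ((fg_WW x).pow m)

lemma finrank_WW_pow_le {d : ℕ} (y : Fin d → A) (m : ℕ) :
    Module.finrank K ((WW (K := K) y) ^ m : Submodule K A) ≤ (MM d m).card := by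
  have hfin : ((fun α : Fin d → ℕ => ∏ i, y i ^ α i) '' (MM d m : Set (Fin d → ℕ))).Finite :=
    (Finset.finite_toSet _).image _
  have : Module.Finite K (Submodule.span K
      ((fun α : Fin d → ℕ => ∏ i, y i ^ α i) '' (MM d m : Set (Fin d → ℕ)))) :=
    Module.Finite.iff_fg.2 (Submodule.fg_span hfin)
  refine (Submodule.finrank_mono (WW_pow_le_span y m)).trans ?_
  rw [← Finset.coe_image]
  exact (finrank_span_finset_le_card _).trans Finset.card_image_le

/-- The subalgebra generated by `y` is exhausted by the powers. -/
lemma mem_adjoin_iff_pow {n : ℕ} (x : Fin n → A) (z : A) :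
    z ∈ Algebra.adjoin K (Set.range x) → ∃ m, z ∈ (WW (K := K) x) ^ m := by
  intro hz
  induction hz using Algebra.adjoin_induction with
  | mem z hz =>
    obtain ⟨i, rfl⟩ := hz
    exact ⟨1, by rw [pow_one]; exact mem_WW x i⟩
  | algebraMap r => exact ⟨0, by rw [pow_zero]; exact Submodule.mem_one.2 ⟨r, rfl⟩⟩
  | add a b _ _ ha hb =>
    obtain ⟨m, hm⟩ := ha
    obtain ⟨k, hk⟩ := hb
    exact ⟨m + k, add_mem (pow_le_pow_of_one_le (one_le_WW x) (Nat.le_add_right _ _) hm)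
      (pow_le_pow_of_one_le (one_le_WW x) (Nat.le_add_left _ _) hk)⟩
  | mul a b _ _ ha hb =>
    obtain ⟨m, hm⟩ := ha
    obtain ⟨k, hk⟩ := hb
    exact ⟨m + k, by rw [pow_add]; exact Submodule.mul_mem_mul hm hk⟩

lemma IsRed.pow_le {U W : Submodule K A} (h : IsRed U W) :
    ∃ c, ∀ j, W ^ (c + j) ≤ U ^ j * W ^ c := by
  obtain ⟨h1, h2, c, hc⟩ := h
  refine ⟨c, fun j => ?_⟩
  induction j with
  | zero => simp
  | succ j ih =>
    calc W ^ (c + (j + 1)) = W * W ^ (c + j) := by rw [← add_assoc, pow_succ']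
      _ ≤ W * (U ^ j * W ^ c) := mul_le_mul' le_rfl ih
      _ = U ^ j * W ^ (c + 1) := by rw [pow_succ]; ring
      _ ≤ U ^ j * (U * W ^ c) := mul_le_mul' le_rfl hc
      _ = _ := by rw [pow_succ]; ring

end Hilb

section HilbUpper
variable {K L : Type} [Field K] [Field L] [Algebra K L]

lemma hilb_upper {n d : ℕ} (x : Fin n → L) (y : Fin d → L)
    (hred : IsRed (K := K) (WW y) (WW x))
    [FiniteDimensional (IntermediateField.adjoin K (Set.range y)) L] :
    ∃ c, ∀ j, Module.finrank K ((WW (K := K) x) ^ j : Submodule K L) ≤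
      Module.finrank (IntermediateField.adjoin K (Set.range y)) L * (MM d (j + c)).card := by
  set E := IntermediateField.adjoin K (Set.range y) with hE
  set U := WW (K := K) y
  set W := WW (K := K) x
  obtain ⟨c, hc⟩ := hred.pow_le
  let w := Module.finBasis E L
  set e := Module.finrank E L
  -- the K-linear map `f ↦ ∑ f i * w i`
  let T : (Fin e → L) →ₗ[K] L :=
    { toFun := fun f => ∑ i, f i * w i
      map_add' := fun f g => by simp [add_mul, Finset.sum_add_distrib]
      map_smul' := fun r f => by simp [Finset.smul_sum] }
  have hden : ∀ v : L, ∃ Δ : L, Δ ≠ 0 ∧ Δ ∈ Algebra.adjoin K (Set.range y) ∧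
      ∀ i, Δ * (w.repr v i : L) ∈ Algebra.adjoin K (Set.range y) := by
    intro v
    have h1 : ∀ i, ∃ r ∈ Algebra.adjoin K (Set.range y), ∃ s ∈ Algebra.adjoin K (Set.range y),
        s ≠ 0 ∧ s * (w.repr v i : L) = r := by
      intro i
      obtain ⟨r, hr, s, hs, h⟩ := IntermediateField.mem_adjoin_iff_div.1 (w.repr v i).2
      by_cases h0 : s = 0
      · refine ⟨0, zero_mem _, 1, one_mem _, one_ne_zero, ?_⟩
        rw [h, h0]; simp
      · exact ⟨r, hr, s, hs, h0, by rw [h]; field_simp⟩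
    choose r hr s hs hs0 h using h1
    refine ⟨∏ i, s i, Finset.prod_ne_zero_iff.2 fun i _ => hs0 i, prod_mem fun i _ => hs i,
      fun i => ?_⟩
    rw [← Finset.mul_prod_erase _ _ (Finset.mem_univ i), mul_comm (s i), mul_assoc, h]
    exact mul_mem (prod_mem fun i _ => hs i) (hr i)
  obtain ⟨S, hS⟩ := ((fg_WW (K := K) x).pow c)
  choose Δ hΔ0 hΔ hΔr using hden
  set D := ∏ v ∈ S, Δ v with hD
  have hD0 : D ≠ 0 := Finset.prod_ne_zero_iff.2 fun i _ => hΔ0 i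
  have h2 : ∀ v : L, ∃ m, v ∈ S → ∀ i, D * (w.repr v i : L) ∈ U ^ m := by
    intro v
    by_cases hv : v ∈ S
    · have : ∀ i, ∃ m, D * (w.repr v i : L) ∈ U ^ m := by
        intro i
        apply mem_adjoin_iff_pow
        rw [hD, ← Finset.mul_prod_erase _ _ hv, mul_comm (Δ v), mul_assoc]
        exact mul_mem (prod_mem fun i _ => hΔ i) (hΔr v i)
      choose m hm using this
      exact ⟨Finset.univ.sup m, fun _ i => pow_le_pow_of_one_le (one_le_WW y)
        (Finset.le_sup (Finset.mem_univ i)) (hm i)⟩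
    · exact ⟨0, fun h => (hv h).elim⟩
  choose m hm using h2
  set M := S.sup m
  have hm' : ∀ v ∈ S, ∀ i, D * (w.repr v i : L) ∈ U ^ M := fun v hv i =>
    pow_le_pow_of_one_le (one_le_WW y) (Finset.le_sup hv) (hm v hv i)
  let mulD : L →ₗ[K] L := LinearMap.mulLeft K D
  have hinj : Function.Injective mulD := fun a b h => mul_left_cancel₀ hD0 h
  have key : ∀ j, (W ^ (c + j)).map mulD ≤
      (Submodule.pi Set.univ fun _ : Fin e => U ^ (M + j)).map T := by
    intro j
    refine (Submodule.map_mono (hc j)).trans ?_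
    rw [Submodule.map_le_iff_le_comap, Submodule.mul_le]
    intro u hu v hv
    rw [← hS] at hv
    induction hv using Submodule.span_induction with
    | mem v hv =>
      refine ⟨fun i => (D * (w.repr v i : L)) * u, ?_, ?_⟩
      · intro i _
        change _ ∈ U ^ (M + j)
        rw [pow_add]
        exact Submodule.mul_mem_mul (hm' v hv i) hu
      · change ∑ i, (D * (w.repr v i : L)) * u * w i = D * (u * v)
        conv_rhs => rw [← w.sum_repr v]
        rw [Finset.mul_sum, Finset.mul_sum]
        refine Finset.sum_congr rfl fun i _ => ?_
        rw [Algebra.smul_def]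
        change _ = D * (u * ((w.repr v i : L) * w i))
        ring
    | zero => rw [mul_zero]; exact zero_mem _
    | add a b _ _ ha hb => rw [mul_add]; exact add_mem ha hb
    | smul r a _ ha => rw [mul_smul_comm]; exact Submodule.smul_mem _ _ ha
  refine ⟨M, fun j => ?_⟩
  have hpi : (Submodule.pi Set.univ fun _ : Fin e => U ^ (M + j)) =
      LinearMap.range (LinearMap.pi fun i : Fin e =>
        (U ^ (M + j)).subtype ∘ₗ LinearMap.proj (R := K) (φ := fun _ : Fin e => (U ^ (M + j) : Submodule K L)) i) := by
    ext f
    simp only [Submodule.mem_pi, Set.mem_univ, forall_true_left, LinearMap.mem_range]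
    constructor
    · intro h
      exact ⟨fun i => ⟨f i, h i⟩, rfl⟩
    · rintro ⟨g, rfl⟩ i
      exact (g i).2
  calc Module.finrank K (W ^ j : Submodule K L)
      ≤ Module.finrank K (W ^ (c + j) : Submodule K L) :=
        Submodule.finrank_mono (pow_le_pow_of_one_le (one_le_WW x) (Nat.le_add_left _ _))
    _ = Module.finrank K ((W ^ (c + j)).map mulD) :=
        LinearEquiv.finrank_eq (Submodule.equivMapOfInjective mulD hinj _)
    _ ≤ Module.finrank K ((Submodule.pi Set.univ fun _ : Fin e => U ^ (M + j)).map T) := by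
        have key' := key j
        rw [hpi] at key' ⊢
        exact Submodule.finrank_mono key'
    _ ≤ Module.finrank K (Fin e → (U ^ (M + j) : Submodule K L)) := by
        rw [hpi]
        exact (Submodule.finrank_map_le _ _).trans (LinearMap.finrank_range_le _)
    _ = e * Module.finrank K (U ^ (M + j) : Submodule K L) := by
        rw [Module.finrank_pi_fintype]; simp
    _ ≤ e * (MM d (M + j)).card := Nat.mul_le_mul_left _ (finrank_WW_pow_le y _)
    _ = _ := by rw [add_comm]

end HilbUpper
end PtBound

namespace PtBound

section AnalyticIndep

variable {K A : Type} [Field K] [CommRing A] [Algebra K A]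

lemma ideal_prod_mem_pow {n : ℕ} (x : Fin n → A) (W : Ideal A) (hx : ∀ i, x i ∈ W)
    (s : Multiset (Fin n)) : (s.map x).prod ∈ W ^ (Multiset.card s) := by
  induction s using Multiset.induction with
  | empty => simp
  | cons a s ih =>
    rw [Multiset.map_cons, Multiset.prod_cons, Multiset.card_cons, pow_succ']
    exact Ideal.mul_mem_mul (hx a) ih

lemma ideal_smul_mem (W : Ideal A) (c : K) {a : A} (h : a ∈ W) : c • a ∈ W := by
  rw [Algebra.smul_def]; exact W.mul_mem_left _ h

lemma ideal_prod_sub_mem {n : ℕ} (x : Fin n → A) (v : Fin n → K) (t : A) (W' W : Ideal A)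
    (hx : ∀ i, x i ∈ W) (ht : t ∈ W) (hd : ∀ i, x i - v i • t ∈ W')
    (s : Multiset (Fin n)) : (s = 0 ∧ (s.map x).prod - (s.map v).prod • t ^ (Multiset.card s) = 0) ∨
      ∃ k, Multiset.card s = k + 1 ∧
      (s.map x).prod - (s.map v).prod • t ^ (k + 1) ∈ W' * W ^ k := by
  induction s using Multiset.induction with
  | empty => left; simp
  | cons a s ih =>
    right
    refine ⟨Multiset.card s, by simp, ?_⟩
    have key : ((a ::ₘ s).map x).prod - ((a ::ₘ s).map v).prod • t ^ (Multiset.card s + 1)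
        = (x a - v a • t) * (s.map x).prod +
          v a • (t * ((s.map x).prod - (s.map v).prod • t ^ (Multiset.card s))) := by
      simp only [Multiset.map_cons, Multiset.prod_cons, Algebra.smul_def, map_mul, pow_succ]
      ring
    rw [key]
    refine add_mem (Ideal.mul_mem_mul (hd a) (ideal_prod_mem_pow x W hx s))
      (ideal_smul_mem _ _ ?_)
    rcases ih with ⟨h1, h2⟩ | ⟨k, h1, h2⟩
    · rw [h2]; simp
    · rw [h1, pow_succ', ← mul_assoc, mul_comm W' W, mul_assoc]
      exact Ideal.mul_mem_mul ht h2

lemma ideal_pow_le_aux (t : A) (W' W : Ideal A) (ht : t ∈ W)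
    (hW2 : W ≤ W' ⊔ Ideal.span {t}) (k : ℕ) :
    W ^ (k + 1) ≤ W' * W ^ k ⊔ Ideal.span {t ^ (k + 1)} := by
  induction k with
  | zero => simpa using hW2
  | succ k ih =>
    calc W ^ (k + 1 + 1) = W * W ^ (k + 1) := by rw [pow_succ']
      _ ≤ (W' ⊔ Ideal.span {t}) * W ^ (k + 1) := Ideal.mul_mono hW2 le_rfl
      _ = W' * W ^ (k + 1) ⊔ Ideal.span {t} * W ^ (k + 1) := Ideal.sup_mul _ _ _
      _ ≤ W' * W ^ (k + 1) ⊔ Ideal.span {t} *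
          (W' * W ^ k ⊔ Ideal.span {t ^ (k + 1)}) := sup_le_sup le_rfl (Ideal.mul_mono le_rfl ih)
      _ = W' * W ^ (k + 1) ⊔ (W' * (Ideal.span {t} * W ^ k) ⊔
          Ideal.span {t ^ (k + 1 + 1)}) := by
        rw [Ideal.mul_sup, Ideal.span_singleton_mul_span_singleton, ← pow_succ',
          mul_left_comm]
      _ ≤ W' * W ^ (k + 1) ⊔ (W' * (W * W ^ k) ⊔
          Ideal.span {t ^ (k + 1 + 1)}) := by
        refine sup_le_sup le_rfl (sup_le_sup (Ideal.mul_mono le_rfl (Ideal.mul_mono ?_ le_rfl)) le_rfl)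
        rw [Ideal.span_singleton_le_iff_mem]; exact ht
      _ = _ := by rw [← pow_succ', ← sup_assoc, sup_idem]

lemma ideal_aeval_sub_mem {n : ℕ} (x : Fin n → A) (v : Fin n → K) (t : A) (W' W : Ideal A)
    (hx : ∀ i, x i ∈ W) (ht : t ∈ W) (hd : ∀ i, x i - v i • t ∈ W')
    (f : MvPolynomial (Fin n) K) (k : ℕ) (hf : f.IsHomogeneous (k + 1)) :
    MvPolynomial.aeval x f - MvPolynomial.eval v f • t ^ (k + 1) ∈ W' * W ^ k := by
  have e1 : ∀ {B : Type} [CommRing B] [Algebra K B] (x : Fin n → B),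
      MvPolynomial.aeval x f = ∑ α ∈ f.support,
        f.coeff α • ((Finsupp.toMultiset α).map x).prod := by
    intro B _ _ x
    conv_lhs => rw [f.as_sum]
    rw [map_sum]
    exact Finset.sum_congr rfl fun α _ => monomial_aeval _ _ _
  have e2 := e1 v
  rw [MvPolynomial.aeval_eq_eval] at e2
  rw [e1 x, e2, Finset.sum_smul, ← Finset.sum_sub_distrib]
  refine Submodule.sum_mem _ fun α hα => ?_
  have hcard : Multiset.card (Finsupp.toMultiset α) = α.degree := by
    rw [Finsupp.card_toMultiset]; rfl
  have hdeg : α.degree = k + 1 := by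
    have := hf (MvPolynomial.mem_support_iff.1 hα)
    rw [Finsupp.degree_eq_weight_one]; exact this
  rw [smul_assoc, ← smul_sub]
  refine ideal_smul_mem _ _ ?_
  rcases ideal_prod_sub_mem x v t W' W hx ht hd (Finsupp.toMultiset α) with ⟨h, _⟩ | ⟨k', h2, h3⟩
  · rw [h] at hcard; simp at hcard; omega
  · obtain rfl : k' = k := by omega
    exact h3

theorem analytic_indep [Infinite K] [IsNoetherianRing A] {d : ℕ} (g : Fin d → A) (P : Ideal A)
    (hP : P ∈ (Ideal.span (Set.range g)).minimalPrimes) (hh : (d : ℕ∞) ≤ P.height)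
    (F : MvPolynomial (Fin d) K) (s : ℕ) (hF : F.IsHomogeneous s)
    (hmem : MvPolynomial.aeval g F ∈ P * (Ideal.span (Set.range g)) ^ s) : F = 0 := by
  by_contra hne
  have hPp : P.IsPrime := hP.1.1
  have hQP : Ideal.span (Set.range g) ≤ P := hP.1.2
  obtain ⟨v, hv⟩ : ∃ v, MvPolynomial.eval v F ≠ 0 := by
    by_contra! h
    exact hne (MvPolynomial.funext (by simpa using h))
  rcases s with _ | k
  · rw [← MvPolynomial.totalDegree_zero_iff_isHomogeneous, MvPolynomial.totalDegree_eq_zero_iff_eq_C] at hF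
    rw [hF] at hmem hv
    simp only [MvPolynomial.algHom_C, pow_zero, Ideal.one_eq_top, Ideal.mul_top] at hmem
    rw [MvPolynomial.eval_C] at hv
    exact hPp.ne_top (Ideal.eq_top_of_isUnit_mem _ hmem ((IsUnit.mk0 _ hv).map (algebraMap K A)))
  set Q := Ideal.span (Set.range g) with hQ
  have hgQ : ∀ i, g i ∈ Q := fun i => Ideal.subset_span ⟨i, rfl⟩
  obtain ⟨i0, hi0⟩ : ∃ i, v i ≠ 0 := by
    by_contra! h
    have : v = 0 := funext h
    rw [this] at hv
    apply hv
    rw [show (0 : Fin d → K) = (fun _ => 0) from rfl]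
    have h0 : MvPolynomial.coeff 0 F = 0 := hF.coeff_eq_zero (by simp)
    rw [MvPolynomial.eval_zero', MvPolynomial.constantCoeff_eq, h0]
  set t : A := (v i0)⁻¹ • g i0 with ht
  set g' : Fin d → A := fun i => g i - v i • t with hg'
  have htQ : t ∈ Q := ideal_smul_mem _ _ (hgQ i0)
  have hg0 : g' i0 = 0 := by
    simp only [hg', ht, smul_smul, mul_inv_cancel₀ hi0, one_smul, sub_self]
  set S : Finset A := (Finset.univ.erase i0).image g' with hS
  set Q' : Ideal A := Ideal.span (S : Set A) with hQ'
  have hgQ' : ∀ i, g' i ∈ Q' := by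
    intro i
    by_cases hi : i = i0
    · rw [hi, hg0]; exact zero_mem _
    · exact Ideal.subset_span (by simp [hS]; exact ⟨i, hi, rfl⟩)
  have hQ'Q : Q' ≤ Q := by
    rw [hQ', Ideal.span_le]
    intro a ha
    simp only [hS, Finset.coe_image, Set.mem_image] at ha
    obtain ⟨i, _, rfl⟩ := ha
    exact sub_mem (hgQ i) (ideal_smul_mem _ _ htQ)
  have hQle : Q ≤ Q' ⊔ Ideal.span {t} := by
    rw [hQ, Ideal.span_le]
    rintro _ ⟨i, rfl⟩
    have : g i = g' i + v i • t := by simp [hg']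
    rw [this]
    exact add_mem (Ideal.mem_sup_left (hgQ' i))
      (Ideal.mem_sup_right (ideal_smul_mem _ _ (Ideal.mem_span_singleton_self t)))
  have h1 := ideal_aeval_sub_mem g v t Q' Q hgQ htQ hgQ' F k hF
  have h2 := ideal_pow_le_aux t Q' Q htQ hQle k
  have h3 : t ^ (k + 1) ∈ Q' ⊔ P * Q ^ (k + 1) := by
    have : MvPolynomial.eval v F • t ^ (k + 1) ∈ Q' ⊔ P * Q ^ (k + 1) := by
      have a1 : MvPolynomial.aeval g F ∈ Q' ⊔ P * Q ^ (k + 1) := Ideal.mem_sup_right hmem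
      have a2 := Ideal.mem_sup_left (T := P * Q ^ (k + 1)) (Ideal.mul_le_left h1)
      have := sub_mem a1 a2
      rwa [sub_sub_cancel] at this
    have := ideal_smul_mem _ (MvPolynomial.eval v F)⁻¹ this
    rwa [smul_smul, inv_mul_cancel₀ hv, one_smul] at this
  have h4 : Q ^ (k + 1) ≤ Q' ⊔ P • Q ^ (k + 1) := by
    refine h2.trans (sup_le (Ideal.mul_le_left.trans le_sup_left) ?_)
    rw [Ideal.span_singleton_le_iff_mem]; exact h3
  obtain ⟨r, hr1, hr2⟩ := Submodule.exists_sub_one_mem_and_smul_le_of_fg_of_le_sup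
    (IsNoetherian.noetherian (Q ^ (k + 1))) le_rfl h4
  have hrP : r ∉ P := by
    intro h
    have := sub_mem h hr1
    rw [sub_sub_cancel] at this
    exact hPp.ne_top ((Ideal.eq_top_iff_one _).2 this)
  have hmin : P ∈ Q'.minimalPrimes := by
    refine ⟨⟨hPp, hQ'Q.trans hQP⟩, fun q hq hqP => ?_⟩
    refine hP.2 ⟨hq.1, ?_⟩ hqP
    have hqp := hq.1
    refine hqp.pow_le_iff (n := k + 1) (by omega) |>.1 ?_
    intro a ha
    have : r * a ∈ q := hq.2 (hr2 (Submodule.smul_mem_pointwise_smul _ _ _ ha))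
    exact (hqp.mem_or_mem this).resolve_left fun h => hrP (hqP h)
  have := (hh.trans (Ideal.height_le_card_of_mem_minimalPrimes_span_finset hmin))
  have h5 : d ≤ S.card := by exact_mod_cast this
  have h6 : S.card ≤ (Finset.univ.erase i0).card := Finset.card_image_le
  rw [Finset.card_erase_of_mem (Finset.mem_univ _), Finset.card_univ, Fintype.card_fin] at h6
  have := i0.pos
  omega

end AnalyticIndep

section Height

variable {K A : Type} [Field K] [CommRing A] [Algebra K A]

lemma mv_ringKrullDim (d : ℕ) : ringKrullDim (MvPolynomial (Fin d) K) = d := by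
  rw [MvPolynomial.ringKrullDim_of_isNoetherianRing]; simp

lemma mv_height [IsAlgClosed K] {d : ℕ} (P : Ideal (MvPolynomial (Fin d) K)) (hP : P.IsMaximal) :
    P.height = d := by
  have : FiniteRingKrullDim (MvPolynomial (Fin d) K) := by
    rw [finiteRingKrullDim_iff_ne_bot_and_top, mv_ringKrullDim]
    exact ⟨WithBot.coe_ne_bot, fun h => ENat.natCast_ne_top d (WithBot.coe_injective h)⟩
  obtain ⟨P0, hP0, hh⟩ := Ideal.exists_isMaximal_height (R := MvPolynomial (Fin d) K)
  rw [mv_ringKrullDim] at hh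
  have hh : P0.height = d := by exact_mod_cast hh
  obtain ⟨x, rfl⟩ := (MvPolynomial.isMaximal_iff_eq_vanishingIdeal_singleton).1 hP
  obtain ⟨x0, rfl⟩ := (MvPolynomial.isMaximal_iff_eq_vanishingIdeal_singleton).1 hP0
  let T : ∀ v : Fin d → K, MvPolynomial (Fin d) K →ₐ[K] MvPolynomial (Fin d) K := fun v =>
    MvPolynomial.aeval fun i => MvPolynomial.X i + MvPolynomial.C (v i)
  have hT : ∀ v w, v + w = 0 → (T v).comp (T w) = AlgHom.id K _ := by
    intro v w hvw
    ext i : 1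
    have : v i + w i = 0 := congrFun hvw i
    have h2 : MvPolynomial.C (σ := Fin d) (v i) + MvPolynomial.C (w i) = 0 := by
      rw [← map_add, this, map_zero]
    simp [T, add_assoc, h2]
  let e : MvPolynomial (Fin d) K ≃ₐ[K] MvPolynomial (Fin d) K :=
    AlgEquiv.ofAlgHom (T (x0 - x)) (T (x - x0)) (hT _ _ (by simp)) (hT _ _ (by simp))
  rw [← hh, ← RingEquiv.height_comap e.toRingEquiv]
  congr 1
  ext f
  rw [Ideal.mem_comap, MvPolynomial.mem_vanishingIdeal_singleton_iff,
    MvPolynomial.mem_vanishingIdeal_singleton_iff]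
  have key : (MvPolynomial.aeval x : MvPolynomial (Fin d) K →ₐ[K] K).comp (T (x0 - x)) =
      MvPolynomial.aeval x0 := by
    ext i : 1
    simp [T]
  have key2 := DFunLike.congr_fun key f
  rw [AlgHom.comp_apply] at key2
  exact Eq.congr_left key2

lemma height_ge [IsAlgClosed K] [IsDomain A] [IsNoetherianRing A] {d : ℕ} (y : Fin d → A)
    (hy : AlgebraicIndependent K y)
    (hIntegral : (MvPolynomial.aeval y : MvPolynomial (Fin d) K →ₐ[K] A).toRingHom.IsIntegral)
    (P : Ideal A) (hP : P.IsMaximal) : (d : ℕ∞) ≤ P.height := by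
  let _ : Algebra (MvPolynomial (Fin d) K) A :=
    (MvPolynomial.aeval y : MvPolynomial (Fin d) K →ₐ[K] A).toRingHom.toAlgebra
  have : Algebra.IsIntegral (MvPolynomial (Fin d) K) A := ⟨hIntegral⟩
  have : FaithfulSMul (MvPolynomial (Fin d) K) A :=
    (faithfulSMul_iff_algebraMap_injective _ _).2 hy
  have : P.LiesOver (P.under (MvPolynomial (Fin d) K)) := ⟨rfl⟩
  have hm : (P.under (MvPolynomial (Fin d) K)).IsMaximal := inferInstance
  have := Ideal.height_eq_height_add_of_liesOver_of_hasGoingDown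
    (P.under (MvPolynomial (Fin d) K)) P
  rw [this, mv_height _ hm]
  exact le_self_add

lemma ringKrullDim_le_of_int [IsDomain A] {d : ℕ} (y : Fin d → A)
    (hIntegral : (MvPolynomial.aeval y : MvPolynomial (Fin d) K →ₐ[K] A).toRingHom.IsIntegral) :
    ringKrullDim A ≤ d := by
  let _ : Algebra (MvPolynomial (Fin d) K) A :=
    (MvPolynomial.aeval y : MvPolynomial (Fin d) K →ₐ[K] A).toRingHom.toAlgebra
  have : Algebra.IsIntegral (MvPolynomial (Fin d) K) A := ⟨hIntegral⟩
  rw [← mv_ringKrullDim (K := K)]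
  refine Order.krullDim_le_of_strictMono
    (PrimeSpectrum.comap (algebraMap (MvPolynomial (Fin d) K) A)) fun P Q h => ?_
  exact Ideal.IsIntegral.comap_lt_comap (R := MvPolynomial (Fin d) K) (I := P.asIdeal)
    (J := Q.asIdeal) h

end Height

end PtBound

namespace PtBound

section LemmaM

variable {K A : Type} [Field K] [CommRing A] [Algebra K A]

lemma submodule_prod_mem_prod {ι : Type} (s : Finset ι) (W : ι → Submodule K A) (f : ι → A)
    (h : ∀ i ∈ s, f i ∈ W i) : ∏ i ∈ s, f i ∈ ∏ i ∈ s, W i := by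
  induction s using Finset.induction_on with
  | empty => simpa using ⟨1, map_one _⟩
  | insert a s ha ih =>
    rw [Finset.prod_insert ha, Finset.prod_insert ha]
    exact Submodule.mul_mem_mul (h a (by simp)) (ih fun i hi => h i (by simp [hi]))

lemma ideal_monom_mem {d : ℕ} (g : Fin d → A) (Q : Ideal A) (hg : ∀ i, g i ∈ Q) (α : Fin d → ℕ) :
    ∏ i, g i ^ α i ∈ Q ^ (∑ i, α i) := by
  rw [← Finset.prod_pow_eq_pow_sum]
  exact Ideal.prod_mem_prod fun i _ => Ideal.pow_mem_pow (hg i) _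

lemma ker_prime (φ : A →ₐ[K] K) : (RingHom.ker φ).IsPrime := RingHom.ker_isPrime φ

lemma aeval_sub_mem_ker (φ : A →ₐ[K] K) (h : A) (p : K[X]) :
    algebraMap K A (p.eval (φ h)) - Polynomial.aeval h p ∈ RingHom.ker φ := by
  rw [RingHom.mem_ker, map_sub, AlgHom.commutes, ← Polynomial.aeval_algHom_apply]
  simp

lemma core [Infinite K] [IsNoetherianRing A] {d N : ℕ} (g : Fin d → A)
    (φ : Fin N → (A →ₐ[K] K)) (h : A) (hinj : Function.Injective fun j => φ j h)
    (hmin : ∀ j, RingHom.ker (φ j) ∈ (Ideal.span (Set.range g)).minimalPrimes)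
    (hht : ∀ j, (d : ℕ∞) ≤ (RingHom.ker (φ j)).height)
    (c : (Fin d → ℕ) → K[X]) (hdeg : ∀ α, (c α).degree < N) (S : Finset (Fin d → ℕ))
    (hsum : ∑ α ∈ S, Polynomial.aeval h (c α) * ∏ i, g i ^ α i = 0) :
    ∀ s, ∀ α ∈ S, ∑ i, α i = s → c α = 0 := by
  intro s
  induction s using Nat.strong_induction_on with
  | _ s ih =>
  intro α0 hα0 hs0
  have key : ∀ j, (c α0).eval (φ j h) = 0 := by
    intro j
    set F : MvPolynomial (Fin d) K := ∑ α ∈ S, if ∑ i, α i = s then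
      MvPolynomial.monomial (Finsupp.equivFunOnFinite.symm α) ((c α).eval (φ j h)) else 0 with hF
    have hhom : F.IsHomogeneous s := by
      refine MvPolynomial.IsHomogeneous.sum _ _ _ fun α _ => ?_
      split_ifs with hh
      · refine MvPolynomial.isHomogeneous_monomial _ ?_
        rw [Finsupp.degree_eq_sum]; simpa using hh
      · exact MvPolynomial.isHomogeneous_zero _ _ _
    have hF0 : F = 0 := by
      refine analytic_indep g _ (hmin j) (hht j) F s hhom ?_
      set Q := Ideal.span (Set.range g) with hQ
      have hgQ : ∀ i, g i ∈ Q := fun i => Ideal.subset_span ⟨i, rfl⟩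
      have hQP : Q ≤ RingHom.ker (φ j) := (hmin j).1.2
      have : MvPolynomial.aeval g F = MvPolynomial.aeval g F -
        ∑ α ∈ S, Polynomial.aeval h (c α) * ∏ i, g i ^ α i := by rw [hsum, sub_zero]
      rw [this, hF, map_sum, ← Finset.sum_sub_distrib]
      refine Submodule.sum_mem _ fun α hα => ?_
      have hm := ideal_monom_mem g Q hgQ α
      split_ifs with hh
      · rw [MvPolynomial.aeval_monomial, Finsupp.prod_fintype _ _ (by simp)]
        simp only [Finsupp.equivFunOnFinite_symm_apply_apply]
        rw [← sub_mul]
        rw [hh] at hm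
        exact Ideal.mul_mem_mul (aeval_sub_mem_ker _ _ _) hm
      · rw [map_zero, zero_sub, neg_mem_iff]
        rcases lt_or_gt_of_ne hh with h1 | h1
        · rw [ih _ h1 α hα rfl]; simp
        · refine Ideal.mul_mem_left _ _ ?_
          have h2 : Q ^ (∑ i, α i) ≤ RingHom.ker (φ j) * Q ^ s := by
            refine (Ideal.pow_le_pow_right (Nat.succ_le_of_lt h1)).trans ?_
            rw [Nat.succ_eq_add_one, pow_succ']
            exact Ideal.mul_mono hQP le_rfl
          exact h2 hm
    have h3 : MvPolynomial.coeff (Finsupp.equivFunOnFinite.symm α0) F = (c α0).eval (φ j h) := by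
      rw [hF, MvPolynomial.coeff_sum, Finset.sum_eq_single α0]
      · rw [if_pos hs0, MvPolynomial.coeff_monomial, if_pos rfl]
      · intro b _ hb
        split_ifs
        · rw [MvPolynomial.coeff_monomial, if_neg]
          exact fun e => hb (Finsupp.equivFunOnFinite.symm.injective e)
        · simp
      · exact fun hh => absurd hα0 hh
    rw [← h3, hF0, MvPolynomial.coeff_zero]
  by_contra hne
  have hcard := Polynomial.card_roots' (c α0)
  have h1 : (Finset.univ.image fun j => φ j h) ⊆ (c α0).roots.toFinset := by
    intro z hz
    obtain ⟨j, _, rfl⟩ := Finset.mem_image.1 hz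
    rw [Multiset.mem_toFinset, Polynomial.mem_roots hne]
    exact key j
  have h2 := Finset.card_le_card h1
  rw [Finset.card_image_of_injective _ hinj, Finset.card_univ, Fintype.card_fin] at h2
  have h3 := Multiset.toFinset_card_le (c α0).roots
  have h4 := (Polynomial.natDegree_lt_iff_degree_lt hne).2 (hdeg α0)
  omega

lemma linIndep_M [Infinite K] [IsNoetherianRing A] {d N : ℕ} (g : Fin d → A)
    (φ : Fin N → (A →ₐ[K] K)) (h : A) (hinj : Function.Injective fun j => φ j h)
    (hmin : ∀ j, RingHom.ker (φ j) ∈ (Ideal.span (Set.range g)).minimalPrimes)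
    (hht : ∀ j, (d : ℕ∞) ≤ (RingHom.ker (φ j)).height) (k : ℕ) :
    LinearIndependent K fun z : Fin N × MM d k => h ^ (z.1 : ℕ) * ∏ i, g i ^ z.2.1 i := by
  rw [Fintype.linearIndependent_iff]
  intro c hc
  set p : (Fin d → ℕ) → K[X] := fun α => if hα : α ∈ MM d k then
    ∑ i : Fin N, Polynomial.C (c (i, ⟨α, hα⟩)) * Polynomial.X ^ (i : ℕ) else 0 with hp
  have hdeg : ∀ α, (p α).degree < N := by
    intro α
    simp only [hp]
    split_ifs with hα
    · refine (Polynomial.degree_sum_fin_lt fun i => c (i, ⟨α, hα⟩))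
    · simp
  have h0 := core g φ h hinj hmin hht p hdeg (MM d k) (by
    rw [← hc, Fintype.sum_prod_type_right, ← Finset.sum_coe_sort (MM d k)]
    refine Finset.sum_congr rfl fun α _ => ?_
    simp only [hp, α.2, dif_pos]
    rw [map_sum, Finset.sum_mul]
    refine Finset.sum_congr rfl fun i _ => ?_
    simp [Algebra.smul_def, mul_assoc])
  rintro ⟨i, α, hα⟩
  have h1 := h0 _ α hα rfl
  have h2 : (p α).coeff i = c (i, ⟨α, hα⟩) := by
    simp only [hp, hα, dif_pos, Polynomial.finsetSum_coeff, Polynomial.coeff_C_mul,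
      Polynomial.coeff_X_pow]
    rw [Finset.sum_eq_single i]
    · simp
    · intro b _ hb
      rw [if_neg (fun e => hb (Fin.ext e.symm)), mul_zero]
    · simp
  rw [← h2, h1, Polynomial.coeff_zero]

theorem count_le [Infinite K] [IsNoetherianRing A] {n d N : ℕ} (x : Fin n → A) (g : Fin d → A)
    (φ : Fin N → (A →ₐ[K] K)) (h : A) (hinj : Function.Injective fun j => φ j h)
    (hmin : ∀ j, RingHom.ker (φ j) ∈ (Ideal.span (Set.range g)).minimalPrimes)
    (hht : ∀ j, (d : ℕ∞) ≤ (RingHom.ker (φ j)).height)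
    (a : ℕ) (ha : 1 ≤ a) (hg : ∀ i, g i ∈ WW (K := K) x ^ a) (hh : h ∈ WW (K := K) x)
    (e c : ℕ) (hub : ∀ j, Module.finrank K ↥(WW (K := K) x ^ j) ≤ e * (MM d (j + c)).card) :
    N ≤ e * a ^ d := by
  refine asym N e a d (N + c) ha fun k => ?_
  have h1 : (1 : Submodule K A) ≤ WW x := one_le_WW x
  have hmem : ∀ z : Fin N × MM d k, h ^ (z.1 : ℕ) * ∏ i, g i ^ z.2.1 i ∈
      WW (K := K) x ^ (a * k + N) := by
    rintro ⟨i, α, hα⟩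
    rw [mem_MM] at hα
    rw [add_comm, pow_add]
    refine Submodule.mul_mem_mul ?_ ?_
    · exact pow_le_pow_of_one_le h1 i.2.le (Submodule.pow_mem_pow _ hh _)
    · refine pow_le_pow_of_one_le h1 (Nat.mul_le_mul_left a hα) ?_
      rw [pow_mul, ← Finset.prod_pow_eq_pow_sum]
      exact submodule_prod_mem_prod _ _ _ fun i _ => Submodule.pow_mem_pow _ (hg i) _
  have hli := linIndep_M g φ h hinj hmin hht k
  have hli2 : LinearIndependent K fun z : Fin N × MM d k =>
      (⟨_, hmem z⟩ : ↥(WW (K := K) x ^ (a * k + N))) :=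
    LinearIndependent.of_comp (Submodule.subtype _) hli
  have h2 := hli2.fintype_card_le_finrank
  have h3 := hub (a * k + N)
  rw [Fintype.card_prod, Fintype.card_fin, Fintype.card_coe] at h2
  rw [add_assoc] at h3
  exact h2.trans h3

lemma exists_sep [Infinite K] {n N : ℕ} (P : Fin N → Fin n → K) (hP : Function.Injective P) :
    ∃ v : Fin n → K, Function.Injective fun j => ∑ i, v i * P j i := by
  set f : MvPolynomial (Fin n) K := ∏ z ∈ (Finset.univ : Finset (Fin N)).offDiag,
    ∑ i, MvPolynomial.C (P z.1 i - P z.2 i) * MvPolynomial.X i with hf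
  have hne : f ≠ 0 := by
    rw [hf, Finset.prod_ne_zero_iff]
    intro z hz h0
    rw [Finset.mem_offDiag] at hz
    apply hz.2.2
    apply hP
    funext i
    have := congrArg (MvPolynomial.eval (Pi.single i 1)) h0
    simp only [map_sum, map_mul, MvPolynomial.eval_C, MvPolynomial.eval_X, Pi.single_apply,
      mul_ite, mul_one, mul_zero, Finset.sum_ite_eq', Finset.mem_univ, if_true, map_zero] at this
    exact sub_eq_zero.1 this
  obtain ⟨v, hv⟩ : ∃ v, MvPolynomial.eval v f ≠ 0 := by
    by_contra! h
    exact hne (MvPolynomial.funext (by simpa using h))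
  refine ⟨v, fun j j' hjj => ?_⟩
  by_contra hne'
  apply hv
  rw [hf, map_prod]
  refine Finset.prod_eq_zero (i := (j, j')) (by simp [hne']) ?_
  simp only [map_sum, map_mul, MvPolynomial.eval_C, MvPolynomial.eval_X, sub_mul,
    Finset.sum_sub_distrib]
  simp only [mul_comm (v _)] at hjj
  rw [hjj, sub_self]

theorem count_le' [Infinite K] [IsNoetherianRing A] {n d N : ℕ} (x : Fin n → A) (g : Fin d → A)
    (φ : Fin N → (A →ₐ[K] K)) (hinj : Function.Injective fun j => fun i => φ j (x i))
    (hmin : ∀ j, RingHom.ker (φ j) ∈ (Ideal.span (Set.range g)).minimalPrimes)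
    (hht : ∀ j, (d : ℕ∞) ≤ (RingHom.ker (φ j)).height)
    (a : ℕ) (ha : 1 ≤ a) (hg : ∀ i, g i ∈ WW (K := K) x ^ a)
    (e c : ℕ) (hub : ∀ j, Module.finrank K ↥(WW (K := K) x ^ j) ≤ e * (MM d (j + c)).card) :
    N ≤ e * a ^ d := by
  obtain ⟨v, hv⟩ := exists_sep _ hinj
  refine count_le x g φ (∑ i, v i • x i) (by simpa using hv) hmin hht a ha hg ?_ e c hub
  exact Submodule.sum_mem _ fun i _ => Submodule.smul_mem _ _ (mem_WW x i)

end LemmaM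

end PtBound

namespace PtBound

section Fibre

variable {K A : Type} [Field K] [CommRing A] [Algebra K A]

lemma exists_hom_of_maximal [IsAlgClosed K] [Algebra.FiniteType K A] (M : Ideal A)
    (hM : M.IsMaximal) : ∃ φ : A →ₐ[K] K, RingHom.ker φ = M := by
  let _ : Field (A ⧸ M) := Ideal.Quotient.field M
  have : Algebra.FiniteType K (A ⧸ M) :=
    Algebra.FiniteType.of_surjective (Ideal.Quotient.mkₐ K M) (Ideal.Quotient.mkₐ_surjective K M)
  have : Module.Finite K (A ⧸ M) := finite_of_finite_type_of_isJacobsonRing K (A ⧸ M)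
  have hb : Function.Bijective (algebraMap K (A ⧸ M)) :=
    IsAlgClosed.algebraMap_bijective_of_isIntegral
  let e : K ≃ₐ[K] (A ⧸ M) := AlgEquiv.ofBijective (Algebra.ofId K (A ⧸ M)) hb
  refine ⟨e.symm.toAlgHom.comp (Ideal.Quotient.mkₐ K M), ?_⟩
  ext z
  rw [RingHom.mem_ker]
  simp [Ideal.Quotient.eq_zero_iff_mem]

lemma ker_isMaximal (φ : A →ₐ[K] K) : (RingHom.ker φ).IsMaximal :=
  RingHom.ker_isMaximal_of_surjective φ fun z => ⟨algebraMap K A z, by simp⟩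

lemma exists_fibre [IsAlgClosed K] [Algebra.FiniteType K A] [IsDomain A] {d : ℕ}
    [Algebra (MvPolynomial (Fin d) K) A] [IsScalarTower K (MvPolynomial (Fin d) K) A]
    [Algebra.IsIntegral (MvPolynomial (Fin d) K) A] [FaithfulSMul (MvPolynomial (Fin d) K) A]
    {E L : Type} [Field E] [Field L] [Algebra (MvPolynomial (Fin d) K) E]
    [IsFractionRing (MvPolynomial (Fin d) K) E] [Algebra E L] [Algebra A L] [IsFractionRing A L]
    [Algebra (MvPolynomial (Fin d) K) L] [IsScalarTower (MvPolynomial (Fin d) K) E L]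
    [IsScalarTower (MvPolynomial (Fin d) K) A L] [FiniteDimensional E L]
    [Algebra.IsSeparable E L] :
    ∃ (b : Fin d → K) (φ : Fin (Module.finrank E L) → (A →ₐ[K] K)), Function.Injective φ ∧
      ∀ j r, φ j (algebraMap (MvPolynomial (Fin d) K) A r) = MvPolynomial.eval b r := by
  set R := MvPolynomial (Fin d) K with hR
  obtain ⟨α, hα⟩ := Field.exists_primitive_element E L
  -- a primitive element in `A`
  obtain ⟨h, hh⟩ : ∃ h : A, IntermediateField.adjoin E {algebraMap A L h} = ⊤ := by
    obtain ⟨a, b, hb, rfl⟩ := IsFractionRing.div_surjective (A := A) α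
    obtain ⟨r, hr, b', hb'⟩ := (Algebra.IsIntegral.isIntegral (R := R) b).isAlgebraic.exists_nonzero_dvd hb
    have hb0 : algebraMap A L b ≠ 0 := by
      rw [Ne, FaithfulSMul.algebraMap_eq_zero_iff]; exact nonZeroDivisors.ne_zero hb
    have hr0 : algebraMap R E r ≠ 0 := by
      rw [Ne, FaithfulSMul.algebraMap_eq_zero_iff]; exact hr
    refine ⟨a * b', ?_⟩
    rw [eq_top_iff, ← hα, IntermediateField.adjoin_simple_le_iff]
    have : algebraMap A L a / algebraMap A L b =
        algebraMap A L (a * b') * algebraMap E L (algebraMap R E r)⁻¹ := by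
      rw [map_inv₀, ← IsScalarTower.algebraMap_apply R E L, IsScalarTower.algebraMap_apply R A L, hb',
        map_mul, map_mul]
      have hb'0 : algebraMap A L b' ≠ 0 := by
        intro h0
        apply hr
        rw [FaithfulSMul.algebraMap_eq_zero_iff] at h0
        rw [h0, mul_zero, FaithfulSMul.algebraMap_eq_zero_iff] at hb'
        exact hb'
      field_simp
    rw [this]
    exact mul_mem (IntermediateField.mem_adjoin_simple_self E _) (IntermediateField.algebraMap_mem _ _)
  have hIntegral : IsIntegral R h := Algebra.IsIntegral.isIntegral h
  set p := minpoly R h with hp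
  have hpm : p.Monic := minpoly.monic hIntegral
  have hmin : minpoly E (algebraMap A L h) = p.map (algebraMap R E) :=
    minpoly.isIntegrallyClosed_eq_field_fractions E L hIntegral
  have hdeg : p.natDegree = Module.finrank E L := by
    rw [← hpm.natDegree_map (algebraMap R E), ← hmin,
      ← IntermediateField.adjoin.finrank (Algebra.IsIntegral.isIntegral _), hh,
      IntermediateField.finrank_top']
  have hsep : (p.map (algebraMap R E)).Separable := by
    rw [← hmin]; exact Algebra.IsSeparable.isSeparable E _
  obtain ⟨Δ, hΔ, u, v, huv⟩ : ∃ Δ : R, Δ ≠ 0 ∧ ∃ u v : R[X],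
      u * p + v * p.derivative = Polynomial.C Δ := by
    obtain ⟨u, v, huv⟩ := hsep
    obtain ⟨c1, hc1, h1⟩ := IsLocalization.integerNormalization_spec (nonZeroDivisors R) u
    obtain ⟨c2, hc2, h2⟩ := IsLocalization.integerNormalization_spec (nonZeroDivisors R) v
    set u' := IsLocalization.integerNormalization (nonZeroDivisors R) u
    set v' := IsLocalization.integerNormalization (nonZeroDivisors R) v
    refine ⟨c1 * c2, mul_ne_zero (nonZeroDivisors.ne_zero hc1) (nonZeroDivisors.ne_zero hc2),
      Polynomial.C (c2 : R) * u', Polynomial.C (c1 : R) * v', ?_⟩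
    apply Polynomial.map_injective (algebraMap R E) (IsFractionRing.injective R E)
    rw [Polynomial.derivative_map] at huv
    have e1 : u'.map (algebraMap R E) = Polynomial.C (algebraMap R E c1) * u := by
      rw [h1, ← Polynomial.smul_eq_C_mul, algebraMap_smul]
    have e2 : v'.map (algebraMap R E) = Polynomial.C (algebraMap R E c2) * v := by
      rw [h2, ← Polynomial.smul_eq_C_mul, algebraMap_smul]
    simp only [Polynomial.map_add, Polynomial.map_mul, Polynomial.map_C, e1, e2, map_mul]
    linear_combination (Polynomial.C (algebraMap R E c1) * Polynomial.C (algebraMap R E c2)) * huv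
  obtain ⟨b, hb⟩ : ∃ b, MvPolynomial.eval b Δ ≠ 0 := by
    have : Infinite K := IsAlgClosed.instInfinite
    by_contra! h
    exact hΔ (MvPolynomial.funext (by simpa using h))
  set pb := p.map (MvPolynomial.eval b : R →+* K) with hpb
  have hpbm : pb.Monic := hpm.map _
  have hsepb : pb.Separable := by
    refine ⟨Polynomial.C (MvPolynomial.eval b Δ)⁻¹ * u.map (MvPolynomial.eval b : R →+* K),
      Polynomial.C (MvPolynomial.eval b Δ)⁻¹ * v.map (MvPolynomial.eval b : R →+* K), ?_⟩
    have := congrArg (Polynomial.map (MvPolynomial.eval b : R →+* K)) huv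
    simp only [Polynomial.map_add, Polynomial.map_mul, Polynomial.map_C,
      ← Polynomial.derivative_map] at this
    rw [← hpb] at this
    rw [mul_assoc, mul_assoc, ← mul_add, this, ← Polynomial.C_mul, inv_mul_cancel₀ hb, Polynomial.C_1]
  have hcard : pb.roots.toFinset.card = Module.finrank E L := by
    rw [Multiset.toFinset_card_of_nodup (Polynomial.nodup_roots hsepb),
      ← (IsAlgClosed.splits pb).natDegree_eq_card_roots, hpb, hpm.natDegree_map, hdeg]
  have hroot : ∀ β ∈ pb.roots.toFinset, ∃ φ : A →ₐ[K] K, φ h = β ∧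
      ∀ r, φ (algebraMap R A r) = MvPolynomial.eval b r := by
    intro β hβ
    rw [Multiset.mem_toFinset, Polynomial.mem_roots hpbm.ne_zero, Polynomial.IsRoot, hpb,
      Polynomial.eval_map] at hβ
    have hev : ∀ z : K, MvPolynomial.eval b (MvPolynomial.C z : R) = z := fun z =>
      MvPolynomial.eval_C z
    let ψ : R[X] →+* K := Polynomial.eval₂RingHom (MvPolynomial.eval b) β
    have hψ : Function.Surjective ψ := fun z => ⟨Polynomial.C (MvPolynomial.C z), by simp [ψ, hev]⟩
    let _ : Algebra R[X] A := (Polynomial.aeval (R := R) h).toRingHom.toAlgebra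
    have : IsScalarTower R R[X] A := IsScalarTower.of_algebraMap_eq fun r => by
      simp [RingHom.algebraMap_toAlgebra]
    have : Algebra.IsIntegral R[X] A := Algebra.IsIntegral.tower_top R
    have hm : (RingHom.ker ψ).IsMaximal := RingHom.ker_isMaximal_of_surjective ψ hψ
    obtain ⟨M, hM, hMc⟩ := Ideal.exists_ideal_over_maximal_of_isIntegral (S := A) (RingHom.ker ψ) (by
      intro q hq
      have : p ∣ q := minpoly.isIntegrallyClosed_dvd hIntegral hq
      obtain ⟨s, rfl⟩ := this
      rw [RingHom.mem_ker, map_mul]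
      have : ψ p = 0 := hβ
      rw [this, zero_mul])
    obtain ⟨φ, hφ⟩ := exists_hom_of_maximal (K := K) M hM
    have key : ∀ q : R[X], φ (Polynomial.aeval h q) = ψ q := by
      intro q
      have h1 : q - Polynomial.C (MvPolynomial.C (ψ q)) ∈ RingHom.ker ψ := by
        rw [RingHom.mem_ker, map_sub]; simp [ψ, hev]
      rw [← hMc, Ideal.mem_comap, ← hφ, RingHom.mem_ker] at h1
      have h2 : algebraMap R[X] A (q - Polynomial.C (MvPolynomial.C (ψ q))) =
        Polynomial.aeval h q - algebraMap K A (ψ q) := by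
        change Polynomial.aeval h _ = _
        rw [map_sub, Polynomial.aeval_C, ← MvPolynomial.algebraMap_eq,
          ← IsScalarTower.algebraMap_apply K R A]
      rw [h2, map_sub, AlgHom.commutes, sub_eq_zero] at h1
      exact h1
    refine ⟨φ, ?_, fun r => ?_⟩
    · have := key Polynomial.X
      simpa [ψ] using this
    · have := key (Polynomial.C r)
      simpa [ψ] using this
  choose Φ hΦ1 hΦ2 using hroot
  let ε := pb.roots.toFinset.equivFinOfCardEq hcard
  refine ⟨b, fun j => Φ (ε.symm j) (ε.symm j).2, fun i j hij => ?_,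
    fun j r => hΦ2 _ (ε.symm j).2 r⟩
  have h3 : Φ (ε.symm i) (ε.symm i).2 h = Φ (ε.symm j) (ε.symm j).2 h :=
    congrArg (fun φ : A →ₐ[K] K => φ h) hij
  rw [hΦ1, hΦ1] at h3
  exact ε.symm.injective (Subtype.ext h3)

end Fibre

end PtBound

namespace PtBound

section Data

variable {K A : Type} [Field K] [CommRing A] [Algebra K A]

lemma integral_of_red [IsDomain A] {n d : ℕ} (x : Fin n → A) (y : Fin d → A)
    (hx : Algebra.adjoin K (Set.range x) = ⊤) (hred : IsRed (K := K) (WW y) (WW x)) :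
    (MvPolynomial.aeval y : MvPolynomial (Fin d) K →ₐ[K] A).toRingHom.IsIntegral := by
  let _ : Algebra (MvPolynomial (Fin d) K) A :=
    (MvPolynomial.aeval y : MvPolynomial (Fin d) K →ₐ[K] A).toRingHom.toAlgebra
  have hmap : ∀ r, algebraMap (MvPolynomial (Fin d) K) A r = MvPolynomial.aeval y r := fun r => rfl
  have htow : IsScalarTower K (MvPolynomial (Fin d) K) A := by
    refine IsScalarTower.of_algebraMap_eq (fun r => ?_)
    rw [hmap, MvPolynomial.algebraMap_eq, MvPolynomial.aeval_C]
  obtain ⟨h1, h2, c, hc⟩ := hred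
  let N : Submodule (MvPolynomial (Fin d) K) A :=
    Submodule.span (MvPolynomial (Fin d) K) (((WW (K := K) x) ^ c : Submodule K A) : Set A)
  have hWN : ∀ z ∈ (WW (K := K) x) ^ c, z ∈ N := fun z hz => Submodule.subset_span hz
  have hone : (1 : A) ∈ (WW (K := K) x) ^ c := by
    have : (1 : Submodule K A) ≤ (WW (K := K) x) ^ c := one_le_pow_of_one_le' (one_le_WW x) c
    exact this (Submodule.mem_one.2 ⟨1, map_one _⟩)
  have hN0 : N ≠ ⊥ := by
    intro h
    have := hWN 1 hone
    rw [h, Submodule.mem_bot] at this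
    exact one_ne_zero this
  have hfg : N.FG := by
    obtain ⟨s, hs⟩ := (fg_WW (K := K) x).pow c
    refine ⟨s, ?_⟩
    change _ = Submodule.span (MvPolynomial (Fin d) K) (((WW (K := K) x) ^ c : Submodule K A) : Set A)
    rw [← hs, Submodule.span_span_of_tower]
  have hU : ∀ u ∈ WW (K := K) y, ∀ z ∈ N, u * z ∈ N := by
    intro u hu z hz
    have : ∃ r : MvPolynomial (Fin d) K, MvPolynomial.aeval y r = u := by
      rw [WW, Submodule.mem_sup] at hu
      obtain ⟨a, ha, b, hb, rfl⟩ := hu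
      obtain ⟨k, rfl⟩ := Submodule.mem_one.1 ha
      have hb' : b ∈ (MvPolynomial.aeval y : MvPolynomial (Fin d) K →ₐ[K] A).toLinearMap.range := by
        refine (Submodule.span_le.2 ?_) hb
        rintro _ ⟨i, rfl⟩
        exact ⟨MvPolynomial.X i, by simp⟩
      obtain ⟨r, hr⟩ := hb'
      refine ⟨MvPolynomial.C k + r, ?_⟩
      rw [map_add, MvPolynomial.aeval_C, ← hr]; rfl
    obtain ⟨r, rfl⟩ := this
    rw [← hmap, ← Algebra.smul_def]
    exact N.smul_mem r hz
  have hUW : WW (K := K) y * (WW (K := K) x) ^ c ≤ N.restrictScalars K := by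
    rw [Submodule.mul_le]
    intro u hu z hz
    exact hU u hu z (hWN z hz)
  have hX : ∀ i, ∀ z ∈ N, x i • z ∈ N := by
    intro i z hz
    induction hz using Submodule.span_induction with
    | mem z hz =>
      apply hUW
      apply hc
      rw [smul_eq_mul, pow_succ']
      exact Submodule.mul_mem_mul (mem_WW x i) hz
    | zero => simp
    | add a b _ _ ha hb => rw [smul_add]; exact N.add_mem ha hb
    | smul r a _ ha => rw [smul_comm]; exact N.smul_mem r ha
  have hIntegral : ∀ z : A, IsIntegral (MvPolynomial (Fin d) K) z := by
    intro z
    have hz : z ∈ Algebra.adjoin K (Set.range x) := by rw [hx]; trivial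
    induction hz using Algebra.adjoin_induction with
    | mem z hz =>
      obtain ⟨i, rfl⟩ := hz
      exact isIntegral_of_smul_mem_submodule N hN0 hfg (x i) (hX i)
    | algebraMap r =>
      rw [IsScalarTower.algebraMap_apply K (MvPolynomial (Fin d) K) A]
      exact isIntegral_algebraMap
    | add a b _ _ ha hb => exact ha.add hb
    | mul a b _ _ ha hb => exact ha.mul hb
  exact hIntegral

lemma map_WW {B : Type} [CommRing B] [Algebra K B] (f : A →ₐ[K] B) {n : ℕ} (x : Fin n → A) :
    (WW (K := K) x).map f.toLinearMap = WW (K := K) (fun i => f (x i)) := by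
  rw [WW, WW, Submodule.map_sup, Submodule.map_span, ← Set.range_comp, Submodule.map_one]
  rfl

lemma map_WW_pow {B : Type} [CommRing B] [Algebra K B] (f : A →ₐ[K] B) {n : ℕ} (x : Fin n → A)
    (m : ℕ) : ((WW (K := K) x) ^ m).map f.toLinearMap = (WW (K := K) (fun i => f (x i))) ^ m := by
  rw [Submodule.map_pow, map_WW]

lemma isRed_of_map {B : Type} [CommRing B] [Algebra K B] (f : A →ₐ[K] B)
    (hf : Function.Injective f) {n d : ℕ} (x : Fin n → A) (y : Fin d → A)
    (h : IsRed (K := K) (WW fun i => f (y i)) (WW fun i => f (x i))) :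
    IsRed (K := K) (WW y) (WW x) := by
  have hle : ∀ P Q : Submodule K A, P.map f.toLinearMap ≤ Q.map f.toLinearMap → P ≤ Q :=
    fun P Q h => (Submodule.map_le_map_iff_of_injective hf P Q).1 h
  obtain ⟨h1, h2, c, hc⟩ := h
  refine ⟨one_le_WW y, hle _ _ ?_, c, hle _ _ ?_⟩
  · rw [map_WW, map_WW]; exact h2
  · rw [Submodule.map_mul, map_WW_pow, map_WW_pow, map_WW]; exact hc

theorem noether_data_aux (L : Type) [Field L] [Algebra A L] [Algebra K L] [IsScalarTower K A L]
    [IsFractionRing A L] [IsAlgClosed K] (p : ℕ) [Fact p.Prime] [CharP K p] [IsDomain A]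
    {n : ℕ} (x : Fin n → A) (hx : Algebra.adjoin K (Set.range x) = ⊤) :
    ∃ (d : ℕ) (y : Fin d → A), AlgebraicIndependent K y ∧
      (∀ i, y i ∈ Submodule.span K (Set.range x)) ∧ IsRed (K := K) (WW y) (WW x) ∧
      (MvPolynomial.aeval y : MvPolynomial (Fin d) K →ₐ[K] A).toRingHom.IsIntegral ∧
      ∃ e c : ℕ, (∀ j, Module.finrank K ((WW (K := K) x) ^ j : Submodule K A) ≤
        e * (MM d (j + c)).card) ∧
      ∃ (b : Fin d → K) (φ : Fin e → (A →ₐ[K] K)), Function.Injective φ ∧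
        ∀ j i, φ j (y i) = b i := by
  let f : A →ₐ[K] L := IsScalarTower.toAlgHom K A L
  have hf : Function.Injective f := IsFractionRing.injective A L
  obtain ⟨d, y', hai, hspan, hred, hsep⟩ := noether (K := K) p (fun i => f (x i))
  have hlift : ∀ i, ∃ y ∈ Submodule.span K (Set.range x), f y = y' i := by
    intro i
    have := hspan i
    have e : Set.range (fun i => f (x i)) = f.toLinearMap '' Set.range x := by
      rw [← Set.range_comp]; rfl
    rw [e, ← Submodule.map_span] at this
    exact this
  choose y hy hfy using hlift
  obtain rfl : (fun i => f (y i)) = y' := funext hfy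
  have haiy : AlgebraicIndependent K y := AlgebraicIndependent.of_comp f hai
  have hredy := isRed_of_map f hf x y hred
  have hIntegral := integral_of_red x y hx hredy
  set E := IntermediateField.adjoin K (Set.range fun i => f (y i)) with hE
  have htop : IntermediateField.adjoin E (Set.range fun i => f (x i)) = ⊤ := by
    rw [eq_top_iff]
    rintro z -
    obtain ⟨a, b, hb, rfl⟩ := IsFractionRing.div_surjective (A := A) z
    have : ∀ a : A, f a ∈ IntermediateField.adjoin E (Set.range fun i => f (x i)) := by
      intro a
      have ha : a ∈ Algebra.adjoin K (Set.range x) := by rw [hx]; trivial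
      induction ha using Algebra.adjoin_induction with
      | mem z hz =>
        obtain ⟨i, rfl⟩ := hz
        exact IntermediateField.subset_adjoin _ _ ⟨i, rfl⟩
      | algebraMap r =>
        rw [AlgHom.commutes, IsScalarTower.algebraMap_apply K E L]
        exact IntermediateField.algebraMap_mem _ _
      | add a b _ _ ha hb => rw [map_add]; exact add_mem ha hb
      | mul a b _ _ ha hb => rw [map_mul]; exact mul_mem ha hb
    exact div_mem (this a) (this b)
  have hfd0 : FiniteDimensional E (IntermediateField.adjoin E (Set.range fun i => f (x i))) := by
    apply IntermediateField.finiteDimensional_adjoin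
    rintro _ ⟨i, rfl⟩
    exact (hsep i).isIntegral
  have hsep0 : Algebra.IsSeparable E (IntermediateField.adjoin E (Set.range fun i => f (x i))) := by
    rw [IntermediateField.isSeparable_adjoin_iff_isSeparable]
    rintro _ ⟨i, rfl⟩
    exact hsep i
  rw [htop] at hfd0 hsep0
  have hfd : FiniteDimensional E L :=
    LinearEquiv.finiteDimensional (IntermediateField.topEquiv (F := E) (E := L)).toLinearEquiv
  have hsepL : Algebra.IsSeparable E L :=
    Algebra.IsSeparable.of_algHom E _ (IntermediateField.topEquiv (F := E) (E := L)).symm.toAlgHom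
  obtain ⟨c, hc⟩ := hilb_upper (fun i => f (x i)) (fun i => f (y i)) hred
  refine ⟨d, y, haiy, hy, hredy, hIntegral, Module.finrank E L, c, fun j => ?_, ?_⟩
  · have := hc j
    rw [← map_WW_pow] at this
    rwa [LinearEquiv.finrank_eq (Submodule.equivMapOfInjective f.toLinearMap hf _).symm] at this
  · let R := MvPolynomial (Fin d) K
    let yE : Fin d → E := fun i => ⟨f (y i), IntermediateField.subset_adjoin _ _ ⟨i, rfl⟩⟩
    let _ : Algebra R A := (MvPolynomial.aeval y : R →ₐ[K] A).toRingHom.toAlgebra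
    let _ : Algebra R E := (MvPolynomial.aeval yE : R →ₐ[K] E).toRingHom.toAlgebra
    let _ : Algebra R L := (MvPolynomial.aeval (fun i => f (y i)) : R →ₐ[K] L).toRingHom.toAlgebra
    have hRA : ∀ r : R, algebraMap R A r = MvPolynomial.aeval y r := fun r => rfl
    have hRE : ∀ r : R, algebraMap R E r = MvPolynomial.aeval yE r := fun r => rfl
    have hRL : ∀ r : R, algebraMap R L r = MvPolynomial.aeval (fun i => f (y i)) r := fun r => rfl
    have hREL : ∀ r : R, algebraMap R L r = algebraMap E L (algebraMap R E r) := by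
      intro r
      rw [hRE, hRL, ← MvPolynomial.aeval_algebraMap_apply]
      rfl
    have hRAL : ∀ r : R, algebraMap R L r = algebraMap A L (algebraMap R A r) := by
      intro r
      rw [hRA, hRL, ← MvPolynomial.aeval_algebraMap_apply]
      rfl
    have i1 : IsScalarTower K R A := by
      refine IsScalarTower.of_algebraMap_eq (fun r => ?_)
      rw [hRA, MvPolynomial.algebraMap_eq, MvPolynomial.aeval_C]
    have i2 : IsScalarTower R E L := IsScalarTower.of_algebraMap_eq hREL
    have i3 : IsScalarTower R A L := IsScalarTower.of_algebraMap_eq hRAL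
    have i4 : Algebra.IsIntegral R A := ⟨hIntegral⟩
    have hinjA : Function.Injective (algebraMap R A) := haiy
    have i5 : FaithfulSMul R A := (faithfulSMul_iff_algebraMap_injective R A).2 hinjA
    have hinjE : Function.Injective (algebraMap R E) := by
      intro a b hab
      apply hai
      rw [← hRL, ← hRL, hREL, hREL, hab]
    have i5' : FaithfulSMul R E := (faithfulSMul_iff_algebraMap_injective R E).2 hinjE
    have i6 : IsFractionRing R E := by
      refine IsFractionRing.of_field R E (fun z => ?_)
      obtain ⟨u, hu, v, hv, hz⟩ := IntermediateField.mem_adjoin_iff_div.1 z.2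
      rw [Algebra.adjoin_range_eq_range_aeval] at hu hv
      obtain ⟨a, rfl⟩ := hu
      obtain ⟨b, rfl⟩ := hv
      refine ⟨a, b, ?_⟩
      apply (algebraMap E L).injective
      rw [map_div₀, ← hREL, ← hREL]
      exact hz
    have i7 : Algebra.FiniteType K A := ⟨⟨Finset.univ.image x, by simpa using hx⟩⟩
    obtain ⟨b, φ, hφ, hb⟩ := exists_fibre (K := K) (A := A) (d := d) (E := E) (L := L)
    refine ⟨b, φ, hφ, fun j i => ?_⟩
    have := hb j (MvPolynomial.X i)
    rwa [hRA, MvPolynomial.aeval_X, MvPolynomial.eval_X] at this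

theorem noether_data [IsAlgClosed K] (p : ℕ) [Fact p.Prime] [CharP K p] [IsDomain A]
    {n : ℕ} (x : Fin n → A) (hx : Algebra.adjoin K (Set.range x) = ⊤) :
    ∃ (d : ℕ) (y : Fin d → A), AlgebraicIndependent K y ∧
      (∀ i, y i ∈ Submodule.span K (Set.range x)) ∧ IsRed (K := K) (WW y) (WW x) ∧
      (MvPolynomial.aeval y : MvPolynomial (Fin d) K →ₐ[K] A).toRingHom.IsIntegral ∧
      ∃ e c : ℕ, (∀ j, Module.finrank K ((WW (K := K) x) ^ j : Submodule K A) ≤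
        e * (MM d (j + c)).card) ∧
      ∃ (b : Fin d → K) (φ : Fin e → (A →ₐ[K] K)), Function.Injective φ ∧
        ∀ j i, φ j (y i) = b i :=
  noether_data_aux (FractionRing A) p x hx

end Data

end PtBound

namespace PtBound

section Count

variable {K A : Type} [Field K] [CommRing A] [Algebra K A]

lemma min_of_finite [IsAlgClosed K] [Algebra.FiniteType K A] (I : Ideal A)
    (hfin : {φ : A →ₐ[K] K | I ≤ RingHom.ker φ}.Finite) (φ : A →ₐ[K] K)
    (hφ : I ≤ RingHom.ker φ) : RingHom.ker φ ∈ I.minimalPrimes := by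
  have hmax := ker_isMaximal φ
  obtain ⟨P, hP, hPφ⟩ := Ideal.exists_minimalPrimes_le hφ
  have hPp : P.IsPrime := hP.1.1
  have hIP : I ≤ P := hP.1.2
  have : IsJacobsonRing A := isJacobsonRing_of_finiteType (A := K)
  have hjac : P.jacobson = P := (inferInstance : IsJacobsonRing A).out hPp.isRadical
  have hinf : hfin.toFinset.inf (fun ψ : A →ₐ[K] K => if P ≤ RingHom.ker ψ then RingHom.ker ψ else ⊤)
      ≤ P := by
    conv_rhs => rw [← hjac]
    refine le_sInf ?_
    rintro M ⟨hPM, hM⟩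
    obtain ⟨ψ, rfl⟩ := exists_hom_of_maximal (K := K) M hM
    refine (Finset.inf_le (b := ψ) ?_).trans ?_
    · rw [Set.Finite.mem_toFinset]; exact hIP.trans hPM
    · rw [if_pos hPM]
  rw [hPp.inf_le'] at hinf
  obtain ⟨ψ, hψ, hle⟩ := hinf
  split_ifs at hle with h
  · have hψP : RingHom.ker ψ = P := le_antisymm hle h
    have : RingHom.ker ψ = RingHom.ker φ :=
      (ker_isMaximal ψ).eq_of_le hmax.ne_top (hle.trans hPφ)
    rw [← this, hψP]; exact hP
  · exact absurd (top_le_iff.1 hle) hPp.ne_top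

lemma finite_of_stab {n : ℕ} (x : Fin n → A) (hx : Algebra.adjoin K (Set.range x) = ⊤)
    (m0 : ℕ) (h : ∀ m, m0 ≤ m → (WW (K := K) x) ^ (m + 1) ≤ (WW (K := K) x) ^ m) :
    Module.Finite K A := by
  have hall : ∀ k, (WW (K := K) x) ^ (m0 + k) ≤ (WW (K := K) x) ^ m0 := by
    intro k
    induction k with
    | zero => exact le_rfl
    | succ k ih => exact (h (m0 + k) (by omega)).trans ih
  have htop : (WW (K := K) x) ^ m0 = ⊤ := by
    rw [eq_top_iff]
    rintro z -
    obtain ⟨m, hm⟩ := mem_adjoin_iff_pow x z (by rw [hx]; trivial)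
    refine hall m (pow_le_pow_of_one_le (one_le_WW x) ?_ hm)
    omega
  rw [Module.finite_def, ← htop]
  exact (fg_WW x).pow m0

lemma finite_hom [Module.Finite K A] : Finite (A →ₐ[K] K) := by
  infer_instance

lemma finite_homs_of_quot (I : Ideal A) [Module.Finite K (A ⧸ I)] :
    {φ : A →ₐ[K] K | I ≤ RingHom.ker φ}.Finite := by
  have : Finite ((A ⧸ I) →ₐ[K] K) := finite_hom
  refine (Set.finite_range (fun ψ : (A ⧸ I) →ₐ[K] K => ψ.comp (Ideal.Quotient.mkₐ K I))).subset ?_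
  intro φ hφ
  refine ⟨Ideal.Quotient.liftₐ I φ (fun a ha => hφ ha), ?_⟩
  ext a
  rfl

lemma adjoin_map_top {B : Type} [CommRing B] [Algebra K B] (f : A →ₐ[K] B)
    (hf : Function.Surjective f) {n : ℕ} (x : Fin n → A)
    (hx : Algebra.adjoin K (Set.range x) = ⊤) :
    Algebra.adjoin K (Set.range fun i => f (x i)) = ⊤ := by
  have e : Set.range (fun i => f (x i)) = f '' Set.range x := by rw [← Set.range_comp]; rfl
  rw [e, ← AlgHom.map_adjoin, hx, Algebra.map_top]
  exact (AlgHom.range_eq_top f).2 hf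

lemma isRed_map {B : Type} [CommRing B] [Algebra K B] (f : A →ₐ[K] B)
    {n d : ℕ} (x : Fin n → A) (y : Fin d → A)
    (h : IsRed (K := K) (WW y) (WW x)) :
    IsRed (K := K) (WW fun i => f (y i)) (WW fun i => f (x i)) := by
  obtain ⟨h1, h2, c, hc⟩ := h
  refine ⟨one_le_WW _, ?_, c, ?_⟩
  · rw [← map_WW, ← map_WW]; exact Submodule.map_mono h2
  · rw [← map_WW_pow, ← map_WW_pow, ← map_WW, ← Submodule.map_mul]; exact Submodule.map_mono hc

/-- fibres of a reduction are finite -/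
lemma finite_fibre {n d : ℕ} (x : Fin n → A) (y : Fin d → A)
    (hx : Algebra.adjoin K (Set.range x) = ⊤) (hred : IsRed (K := K) (WW y) (WW x))
    (b : Fin d → K) (hy : ∀ i, y i = algebraMap K A (b i)) : Module.Finite K A := by
  obtain ⟨c, hc⟩ := hred.pow_le
  have hU : WW (K := K) y ≤ 1 := by
    refine sup_le le_rfl (Submodule.span_le.2 ?_)
    rintro _ ⟨i, rfl⟩
    rw [hy]
    exact Submodule.mem_one.2 ⟨_, rfl⟩
  refine finite_of_stab x hx c (fun m hm => ?_)
  obtain ⟨k, rfl⟩ := Nat.exists_eq_add_of_le hm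
  calc (WW (K := K) x) ^ (c + k + 1) ≤ (WW (K := K) y) ^ (k + 1) * (WW (K := K) x) ^ c := hc (k + 1)
    _ ≤ 1 ^ (k + 1) * (WW (K := K) x) ^ c := mul_le_mul' (pow_le_pow_left' hU _) le_rfl
    _ = (WW (K := K) x) ^ c := by rw [one_pow, one_mul]
    _ ≤ _ := pow_le_pow_of_one_le (one_le_WW x) (by omega)

lemma finite_frob {n d : ℕ} (x : Fin n → A) (y : Fin d → A)
    (hx : Algebra.adjoin K (Set.range x) = ⊤) (hred : IsRed (K := K) (WW y) (WW x))
    (q : ℕ) (hq : 2 ≤ q) (hy : ∀ i, y i ^ q ∈ WW (K := K) x) : Module.Finite K A := by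
  obtain ⟨c, hc⟩ := hred.pow_le
  have hUW := hred.2.1
  have hx1 := one_le_WW (K := K) x
  refine finite_of_stab x hx (c + d * (q - 1)) (fun m hm => ?_)
  obtain ⟨k, rfl⟩ := Nat.exists_eq_add_of_le (show c ≤ m by omega)
  refine (hc (k + 1)).trans ?_
  rw [Submodule.mul_le]
  intro u hu z hz
  have hspan := WW_pow_le_span y (k + 1) hu
  clear hu
  induction hspan using Submodule.span_induction with
  | zero => rw [zero_mul]; exact Submodule.zero_mem _
  | add a b _ _ ha hb => rw [add_mul]; exact Submodule.add_mem _ ha hb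
  | smul r a _ ha => rw [smul_mul_assoc]; exact Submodule.smul_mem _ _ ha
  | mem u hu =>
    obtain ⟨α, hα, rfl⟩ := hu
    have hα' : ∑ i, α i ≤ k + 1 := mem_MM.1 hα
    have hmon : ∀ β : Fin d → ℕ, ∀ t, ∑ i, β i ≤ t → ∏ i, y i ^ β i ∈ (WW (K := K) x) ^ t := by
      intro β t ht
      refine pow_le_pow_of_one_le hx1 ht ?_
      rw [← Finset.prod_pow_eq_pow_sum]
      exact submodule_prod_mem_prod _ _ _ (fun i _ => Submodule.pow_mem_pow _ (hUW (mem_WW y i)) _)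
    by_cases hk : ∑ i, α i ≤ k
    · rw [add_comm c k, pow_add]
      exact Submodule.mul_mem_mul (hmon α k hk) hz
    · have : ∃ i, q ≤ α i := by
        by_contra! hcon
        have : ∑ i, α i ≤ ∑ _i : Fin d, (q - 1) := Finset.sum_le_sum (fun i _ => by have := hcon i; omega)
        simp at this
        omega
      obtain ⟨i, hi⟩ := this
      have e : ∏ j, y j ^ α j = y i ^ q * ∏ j, y j ^ (Function.update α i (α i - q)) j := by
        rw [← Finset.mul_prod_erase _ _ (Finset.mem_univ i),
          ← Finset.mul_prod_erase _ (fun j => y j ^ (Function.update α i (α i - q)) j) (Finset.mem_univ i), ← mul_assoc,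
          Function.update_self, ← pow_add, Nat.add_sub_cancel' hi]
        congr 1
        refine Finset.prod_congr rfl (fun j hj => ?_)
        rw [Function.update_of_ne (Finset.ne_of_mem_erase hj)]
      have es : ∑ j, (Function.update α i (α i - q)) j + q = ∑ j, α j := by
        rw [← Finset.add_sum_erase _ _ (Finset.mem_univ i),
          ← Finset.add_sum_erase _ α (Finset.mem_univ i), Function.update_self]
        have : ∑ j ∈ Finset.univ.erase i, (Function.update α i (α i - q)) j
            = ∑ j ∈ Finset.univ.erase i, α j := by
          refine Finset.sum_congr rfl (fun j hj => ?_)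
          rw [Function.update_of_ne (Finset.ne_of_mem_erase hj)]
        rw [this]; omega
      beta_reduce
      rw [e]
      have h1 : y i ^ q * ∏ j, y j ^ (Function.update α i (α i - q)) j ∈
          (WW (K := K) x) ^ (1 + (k + 1 - q)) := by
        rw [pow_add, pow_one]
        exact Submodule.mul_mem_mul (hy i) (hmon _ _ (by omega))
      have h2 := Submodule.mul_mem_mul h1 hz
      rw [← pow_add] at h2
      refine pow_le_pow_of_one_le hx1 ?_ h2
      omega

end Count

end PtBound

namespace PtBound

section Count2

variable {K A : Type} [Field K] [CommRing A] [Algebra K A]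

lemma span_range_le_ker {d : ℕ} (g : Fin d → A) (φ : A →ₐ[K] K) :
    Ideal.span (Set.range g) ≤ RingHom.ker φ ↔ ∀ i, φ (g i) = 0 := by
  rw [Ideal.span_le]
  constructor
  · intro h i
    exact h ⟨i, rfl⟩
  · rintro h _ ⟨i, rfl⟩
    exact h i

lemma inj_pts {n N : ℕ} (x : Fin n → A) (hx : Algebra.adjoin K (Set.range x) = ⊤)
    (φ : Fin N → (A →ₐ[K] K)) (hφ : Function.Injective φ) :
    Function.Injective fun j => fun i => φ j (x i) := by
  intro j j' h
  apply hφ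
  refine AlgHom.ext_of_adjoin_eq_top hx ?_
  rintro _ ⟨i, rfl⟩
  exact congrFun h i

lemma finiteType_of_adjoin {n : ℕ} (x : Fin n → A) (hx : Algebra.adjoin K (Set.range x) = ⊤) :
    Algebra.FiniteType K A := ⟨⟨Finset.univ.image x, by simpa using hx⟩⟩

lemma count_gen [IsAlgClosed K] [IsDomain A] {n d : ℕ} (x : Fin n → A)
    (hx : Algebra.adjoin K (Set.range x) = ⊤) (y : Fin d → A) (hy : AlgebraicIndependent K y)
    (hIntegral : (MvPolynomial.aeval y : MvPolynomial (Fin d) K →ₐ[K] A).toRingHom.IsIntegral)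
    (e c : ℕ) (hub : ∀ j, Module.finrank K ((WW (K := K) x) ^ j : Submodule K A) ≤
        e * (MM d (j + c)).card)
    (a : ℕ) (ha : 1 ≤ a) (g : Fin d → A) (hg : ∀ i, g i ∈ (WW (K := K) x) ^ a)
    (hfin : {φ : A →ₐ[K] K | Ideal.span (Set.range g) ≤ RingHom.ker φ}.Finite)
    (N : ℕ) (φ : Fin N → (A →ₐ[K] K)) (hφ : Function.Injective φ)
    (h0 : ∀ j i, φ j (g i) = 0) : N ≤ e * a ^ d := by
  have : Algebra.FiniteType K A := finiteType_of_adjoin x hx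
  have : IsNoetherianRing A := Algebra.FiniteType.isNoetherianRing K A
  exact count_le' x g φ (inj_pts x hx φ hφ)
    (fun j => min_of_finite _ hfin _ ((span_range_le_ker g _).2 (h0 j)))
    (fun j => height_ge y hy hIntegral _ (ker_isMaximal _)) a ha hg e c hub

lemma span_le_WW {n : ℕ} (x : Fin n → A) (z : A) (hz : z ∈ Submodule.span K (Set.range x)) :
    z ∈ WW (K := K) x := (le_sup_right : _ ≤ WW (K := K) x) hz

lemma count_q [IsAlgClosed K] [IsDomain A] {n d : ℕ} (x : Fin n → A)
    (hx : Algebra.adjoin K (Set.range x) = ⊤) (y : Fin d → A) (hy : AlgebraicIndependent K y)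
    (hspan : ∀ i, y i ∈ Submodule.span K (Set.range x))
    (hred : IsRed (K := K) (WW y) (WW x))
    (hIntegral : (MvPolynomial.aeval y : MvPolynomial (Fin d) K →ₐ[K] A).toRingHom.IsIntegral)
    (e c : ℕ) (hub : ∀ j, Module.finrank K ((WW (K := K) x) ^ j : Submodule K A) ≤
        e * (MM d (j + c)).card)
    (p : ℕ) [Fact p.Prime] [CharP K p] (k : ℕ) (hk : k ≠ 0)
    (N : ℕ) (φ : Fin N → (A →ₐ[K] K)) (hφ : Function.Injective φ)
    (h0 : ∀ j i, φ j (x i) ^ (p ^ k) = φ j (x i)) : N ≤ e * (p ^ k) ^ d := by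
  have hp : p.Prime := Fact.out
  have hq : 2 ≤ p ^ k := hp.two_le.trans (Nat.le_self_pow hk p)
  have := fun i => (Submodule.mem_span_range_iff_exists_fun K).1 (hspan i)
  choose a ha using this
  let g : Fin d → A := fun i => y i ^ (p ^ k) - ∑ j, a i j ^ (p ^ k) • x j
  have hsum : ∀ i, ∑ j, a i j ^ (p ^ k) • x j ∈ WW (K := K) x := fun i =>
    Submodule.sum_mem _ (fun j _ => Submodule.smul_mem _ _ (mem_WW x j))
  have hx1 := one_le_WW (K := K) x
  have hfinq : Module.Finite K (A ⧸ Ideal.span (Set.range g)) := by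
    let f := Ideal.Quotient.mkₐ K (Ideal.span (Set.range g))
    refine finite_frob (fun i => f (x i)) (fun i => f (y i))
      (adjoin_map_top f (Ideal.Quotient.mkₐ_surjective K _) x hx) (isRed_map f x y hred) (p ^ k) hq
      (fun i => ?_)
    have e1 : f (y i) ^ (p ^ k) = f (∑ j, a i j ^ (p ^ k) • x j) := by
      rw [← map_pow, ← sub_eq_zero, ← map_sub]
      exact Ideal.Quotient.eq_zero_iff_mem.2 (Ideal.subset_span ⟨i, rfl⟩)
    rw [e1, ← map_WW]
    exact Submodule.mem_map_of_mem (hsum i)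
  refine count_gen x hx y hy hIntegral e c hub (p ^ k) (by omega) g (fun i => ?_)
    (finite_homs_of_quot _) N φ hφ (fun j i => ?_)
  · refine Submodule.sub_mem _ (Submodule.pow_mem_pow _ (span_le_WW x _ (hspan i)) _) ?_
    have := pow_le_pow_of_one_le hx1 (show 1 ≤ p ^ k by omega)
    rw [pow_one] at this
    exact this (hsum i)
  · have : ExpChar K p := .prime hp
    simp only [g]
    rw [map_sub, map_pow, ← ha i, map_sum, map_sum, sum_pow_char_pow, sub_eq_zero]
    refine Finset.sum_congr rfl (fun l _ => ?_)
    rw [map_smul, map_smul, smul_eq_mul, smul_eq_mul, mul_pow, h0]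

lemma fibre_finite_homs {n d : ℕ} (x : Fin n → A)
    (hx : Algebra.adjoin K (Set.range x) = ⊤) (y : Fin d → A)
    (hred : IsRed (K := K) (WW y) (WW x)) (b : Fin d → K) :
    {φ : A →ₐ[K] K | ∀ i, φ (y i) = b i}.Finite := by
  let g : Fin d → A := fun i => y i - algebraMap K A (b i)
  have hfinq : Module.Finite K (A ⧸ Ideal.span (Set.range g)) := by
    let f := Ideal.Quotient.mkₐ K (Ideal.span (Set.range g))
    refine finite_fibre (fun i => f (x i)) (fun i => f (y i))
      (adjoin_map_top f (Ideal.Quotient.mkₐ_surjective K _) x hx) (isRed_map f x y hred) b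
      (fun i => ?_)
    rw [← f.commutes, ← sub_eq_zero, ← map_sub]
    exact Ideal.Quotient.eq_zero_iff_mem.2 (Ideal.subset_span ⟨i, rfl⟩)
  refine (finite_homs_of_quot (K := K) (Ideal.span (Set.range g))).subset ?_
  intro φ hφ
  refine (span_range_le_ker g φ).2 (fun i => ?_)
  simp only [g]
  rw [map_sub, AlgHom.commutes, hφ i]
  simp

/-- the set of points of the variety attached to generators `x` of `A` -/
def Pts (K : Type) {A : Type} [Field K] [CommRing A] [Algebra K A] {n : ℕ} (x : Fin n → A) :
    Set (Fin n → K) :=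
  {v | ∃ φ : A →ₐ[K] K, ∀ i, φ (x i) = v i}

lemma exists_homs_of_finite {n : ℕ} (x : Fin n → A) (S : Set (Fin n → K)) (hS : S ⊆ Pts K x)
    (hfin : S.Finite) : ∃ φ : Fin S.ncard → (A →ₐ[K] K), Function.Injective φ ∧
      ∀ j, (fun i => φ j (x i)) ∈ S := by
  have : Fintype S := hfin.fintype
  have hc : Fintype.card S = S.ncard := by rw [Set.ncard_eq_toFinset_card', Set.toFinset_card]
  let eq : Fin S.ncard ≃ S := (Fintype.equivFinOfCardEq hc).symm
  have := fun s : S => hS s.2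
  choose ψ hψ using this
  refine ⟨fun j => ψ (eq j), fun j j' h => ?_, fun j => ?_⟩
  · apply eq.injective
    apply Subtype.ext
    funext i
    rw [← hψ, ← hψ]
    exact congrArg (fun φ : A →ₐ[K] K => φ (x i)) h
  · have : (fun i => ψ (eq j) (x i)) = (eq j : Fin n → K) := funext (hψ _)
    rw [this]; exact (eq j).2

lemma d_le_n [Nontrivial A] {n d : ℕ} (x : Fin n → A) (y : Fin d → A) (hy : AlgebraicIndependent K y)
    (hspan : ∀ i, y i ∈ Submodule.span K (Set.range x)) : d ≤ n := by
  have hli := hy.linearIndependent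
  have h1 : LinearIndependent K (fun i => (⟨y i, hspan i⟩ : Submodule.span K (Set.range x))) :=
    LinearIndependent.of_comp (Submodule.span K (Set.range x)).subtype hli
  have : Module.Finite K (Submodule.span K (Set.range x)) :=
    Module.Finite.span_of_finite K (Set.finite_range x)
  have h2 := h1.fintype_card_le_finrank
  rw [Fintype.card_fin] at h2
  exact h2.trans ((finrank_range_le_card x).trans (by simp))

lemma deg_le [IsAlgClosed K] [IsDomain A] {n d : ℕ} (x : Fin n → A)
    (hx : Algebra.adjoin K (Set.range x) = ⊤) (y : Fin d → A) (hy : AlgebraicIndependent K y)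
    (hspan : ∀ i, y i ∈ Submodule.span K (Set.range x))
    (hIntegral : (MvPolynomial.aeval y : MvPolynomial (Fin d) K →ₐ[K] A).toRingHom.IsIntegral)
    (e c : ℕ) (hub : ∀ j, Module.finrank K ((WW (K := K) x) ^ j : Submodule K A) ≤
        e * (MM d (j + c)).card)
    (L : AffineSubspace K (Fin n → K)) (hL : Module.finrank K L.direction = n - d)
    (hfin : (Pts K x ∩ L).Finite) : (Pts K x ∩ L).ncard ≤ e := by
  have hdn := d_le_n x y hy hspan
  rcases L.eq_bot_or_nonempty with rfl | ⟨v0, hv0⟩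
  · simp
  let D := L.direction
  have hDq : Module.finrank K ((Fin n → K) ⧸ D) = d := by
    have := D.finrank_quotient_add_finrank
    rw [Module.finrank_fin_fun] at this
    change _ + Module.finrank K L.direction = n at this
    omega
  let B := Module.finBasisOfFinrankEq K ((Fin n → K) ⧸ D) hDq
  let ℓ : Fin d → ((Fin n → K) →ₗ[K] K) := fun i => (B.coord i).comp D.mkQ
  have hmem : ∀ v, v ∈ L ↔ ∀ i, ℓ i v = ℓ i v0 := by
    intro v
    rw [← AffineSubspace.vsub_right_mem_direction_iff_mem hv0, ← Submodule.Quotient.mk_eq_zero,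
      ← B.forall_coord_eq_zero_iff]
    refine forall_congr' (fun i => ?_)
    rw [← sub_eq_zero (a := ℓ i v), ← map_sub]
    rfl
  let g : Fin d → A := fun i => ∑ j, (ℓ i (Pi.single j 1)) • x j - algebraMap K A (ℓ i v0)
  have hφg : ∀ (φ : A →ₐ[K] K) i, φ (g i) = ℓ i (fun j => φ (x j)) - ℓ i v0 := by
    intro φ i
    simp only [g]
    rw [map_sub, map_sum, AlgHom.commutes]
    congr 1
    rw [LinearMap.pi_apply_eq_sum_univ (ℓ i)]
    refine Finset.sum_congr rfl (fun j _ => ?_)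
    rw [map_smul, smul_eq_mul, smul_eq_mul, mul_comm]
    congr 2
    funext l
    simp [Pi.single_apply, eq_comm]
  obtain ⟨φ, hφ, hS⟩ := exists_homs_of_finite x (Pts K x ∩ L) Set.inter_subset_left hfin
  have hmain := count_gen x hx y hy hIntegral e c hub 1 le_rfl g (fun i => ?_) ?_ _ φ hφ (fun j i => ?_)
  · simpa using hmain
  · rw [pow_one]
    refine Submodule.sub_mem _ (Submodule.sum_mem _ (fun j _ => Submodule.smul_mem _ _ (mem_WW x j))) ?_
    exact one_le_WW x (Submodule.mem_one.2 ⟨_, rfl⟩)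
  · refine Set.Finite.of_finite_image (f := fun φ : A →ₐ[K] K => fun i => φ (x i)) (hfin.subset ?_) ?_
    · rintro _ ⟨ψ, hψ, rfl⟩
      refine ⟨⟨ψ, fun i => rfl⟩, (hmem _).2 (fun i => ?_)⟩
      have := (span_range_le_ker g ψ).1 hψ i
      rw [hφg, sub_eq_zero] at this
      exact this
    · intro ψ _ ψ' _ h
      refine AlgHom.ext_of_adjoin_eq_top hx ?_
      rintro _ ⟨i, rfl⟩
      exact congrFun h i
  · rw [hφg, sub_eq_zero]
    exact (hmem _).1 (hS j).2 i

lemma deg_ge [IsDomain A] {n d : ℕ} (x : Fin n → A)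
    (hx : Algebra.adjoin K (Set.range x) = ⊤) (y : Fin d → A) (hy : AlgebraicIndependent K y)
    (hspan : ∀ i, y i ∈ Submodule.span K (Set.range x))
    (hred : IsRed (K := K) (WW y) (WW x))
    (e : ℕ) (b : Fin d → K) (φ : Fin e → (A →ₐ[K] K)) (hφ : Function.Injective φ)
    (hb : ∀ j i, φ j (y i) = b i) :
    ∃ L : AffineSubspace K (Fin n → K), Module.finrank K L.direction = n - d ∧
      (Pts K x ∩ L).Finite ∧ e ≤ (Pts K x ∩ L).ncard := by
  have := fun i => (Submodule.mem_span_range_iff_exists_fun K).1 (hspan i)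
  choose a ha using this
  let T : (Fin n → K) →ₗ[K] (Fin d → K) := Matrix.mulVecLin (Matrix.of a)
  have hTφ : ∀ ψ : A →ₐ[K] K, T (fun i => ψ (x i)) = fun i => ψ (y i) := by
    intro ψ
    funext i
    rw [← ha i, map_sum]
    simp [T, Matrix.mulVec, dotProduct]
  have hTs : Function.Surjective T := by
    have hrow : LinearIndependent K a := by
      rw [Fintype.linearIndependent_iff]
      intro s hs
      have hli := hy.linearIndependent
      rw [Fintype.linearIndependent_iff] at hli
      apply hli s
      simp_rw [← ha, Finset.smul_sum, smul_smul]
      rw [Finset.sum_comm]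
      simp_rw [← Finset.sum_smul]
      refine Finset.sum_eq_zero (fun j _ => ?_)
      have := congrFun hs j
      simp only [Finset.sum_apply, Pi.smul_apply, smul_eq_mul, Pi.zero_apply] at this
      rw [this, zero_smul]
    rw [← LinearMap.range_eq_top]
    apply Submodule.eq_top_of_finrank_eq
    have : (Matrix.of a).rank = d := by
      have := LinearIndependent.rank_matrix (M := Matrix.of a) hrow
      simpa using this
    rw [Module.finrank_fin_fun]
    exact this
  obtain ⟨v0, hv0⟩ := hTs b
  let L := AffineSubspace.mk' v0 (LinearMap.ker T)
  have hmem : ∀ v, v ∈ L ↔ T v = b := by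
    intro v
    rw [AffineSubspace.mem_mk', vsub_eq_sub, LinearMap.mem_ker, map_sub, hv0, sub_eq_zero]
  have hfin : (Pts K x ∩ L).Finite := by
    refine ((fibre_finite_homs x hx y hred b).image (fun φ : A →ₐ[K] K => fun i => φ (x i))).subset ?_
    rintro v ⟨⟨ψ, hψ⟩, hvL⟩
    have hv : (fun i => ψ (x i)) = v := funext hψ
    refine ⟨ψ, fun i => ?_, hv⟩
    have := (hmem v).1 hvL
    rw [← hv, hTφ] at this
    exact congrFun this i
  refine ⟨L, ?_, hfin, ?_⟩
  · rw [AffineSubspace.direction_mk']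
    have := T.finrank_range_add_finrank_ker
    rw [LinearMap.range_eq_top.2 hTs, finrank_top, Module.finrank_fin_fun, Module.finrank_fin_fun] at this
    omega
  · have hinj := inj_pts x hx φ hφ
    have : Set.range (fun j => fun i => φ j (x i)) ⊆ Pts K x ∩ L := by
      rintro _ ⟨j, rfl⟩
      refine ⟨⟨φ j, fun i => rfl⟩, (hmem _).2 ?_⟩
      rw [hTφ]
      funext i
      exact hb j i
    have h2 := Set.ncard_le_ncard this hfin
    rw [← Set.image_univ, Set.ncard_image_of_injective _ hinj, Set.ncard_univ] at h2
    simpa using h2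

end Count2

end PtBound

namespace PtBound

section Dim

variable {K : Type} [Field K]

lemma zeroLocus_vanishing {n : ℕ} (Z : Set (Fin n → K)) (hZ : ZarClosed K n Z) :
    MvPolynomial.zeroLocus K (MvPolynomial.vanishingIdeal K Z) = Z := by
  obtain ⟨T, rfl⟩ := hZ
  apply le_antisymm
  · intro v hv f hf
    refine hv f ?_
    intro w hw
    exact hw f hf
  · exact MvPolynomial.zeroLocus_vanishingIdeal_le _

lemma zarClosed_zeroLocus {n : ℕ} (I : Ideal (MvPolynomial (Fin n) K)) :
    ZarClosed K n (MvPolynomial.zeroLocus K I) := ⟨I, rfl⟩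

lemma vanishing_prime {n : ℕ} (Z : Set (Fin n → K)) (hZ : IrredSet K n Z) :
    (MvPolynomial.vanishingIdeal K Z).IsPrime := by
  obtain ⟨⟨v, hv⟩, hirr⟩ := hZ
  refine ⟨?_, ?_⟩
  · rw [Ideal.ne_top_iff_one]
    intro h
    have := h v hv
    rw [map_one] at this
    exact one_ne_zero this
  · intro f g hfg
    have := hirr {x | ∀ h ∈ ({f} : Set (MvPolynomial (Fin n) K)), MvPolynomial.eval x h = 0}
      {x | ∀ h ∈ ({g} : Set (MvPolynomial (Fin n) K)), MvPolynomial.eval x h = 0}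
      ⟨_, rfl⟩ ⟨_, rfl⟩ (by
        intro w hw
        have h := hfg w hw
        rw [map_mul, mul_eq_zero] at h
        rcases h with h | h
        · left
          rintro _ rfl
          exact h
        · right
          rintro _ rfl
          exact h)
    rcases this with h | h
    · left
      intro w hw
      exact h hw f rfl
    · right
      intro w hw
      exact h hw g rfl

lemma irred_zeroLocus [IsAlgClosed K] {n : ℕ} (P : Ideal (MvPolynomial (Fin n) K)) (hP : P.IsPrime) :
    IrredSet K n (MvPolynomial.zeroLocus K P) := by
  have hV : MvPolynomial.vanishingIdeal K (MvPolynomial.zeroLocus K P) = P :=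
    MvPolynomial.IsPrime.vanishingIdeal_zeroLocus P
  refine ⟨?_, ?_⟩
  · rw [Set.nonempty_iff_ne_empty]
    intro h
    rw [h, MvPolynomial.vanishingIdeal_empty] at hV
    exact hP.ne_top hV.symm
  · rintro _ _ ⟨T₁, rfl⟩ ⟨T₂, rfl⟩ hsub
    by_contra! hcon
    obtain ⟨h1, h2⟩ := hcon
    rw [Set.not_subset] at h1 h2
    obtain ⟨v, hv, hv1⟩ := h1
    obtain ⟨w, hw, hw1⟩ := h2
    simp only [Set.mem_ofPred_eq, not_forall] at hv1 hw1
    obtain ⟨f, hf, hfv⟩ := hv1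
    obtain ⟨g, hg, hgw⟩ := hw1
    have hfg : f * g ∈ P := by
      rw [← hV]
      intro u hu
      rw [map_mul, mul_eq_zero]
      rcases hsub hu with h | h
      · exact Or.inl (h f hf)
      · exact Or.inr (h g hg)
    rcases hP.mem_or_mem hfg with h | h
    · exact hfv (hv f h)
    · exact hgw (hw g h)

lemma chain_le {n : ℕ} {B : Type} [CommRing B] (f : MvPolynomial (Fin n) K →+* B)
    (hf : Function.Surjective f) {m : ℕ} (c : Fin (m + 1) → Set (Fin n → K))
    (hc : ∀ i, ZarClosed K n (c i) ∧ IrredSet K n (c i) ∧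
      RingHom.ker f ≤ MvPolynomial.vanishingIdeal K (c i)) (hm : StrictMono c) :
    (m : WithBot ℕ∞) ≤ ringKrullDim B := by
  have hcm : ∀ i, (Ideal.map f (MvPolynomial.vanishingIdeal K (c i))).comap f =
      MvPolynomial.vanishingIdeal K (c i) := by
    intro i
    rw [Ideal.comap_map_of_surjective f hf]
    exact sup_eq_left.2 (hc i).2.2
  let P : Fin (m + 1) → PrimeSpectrum B := fun i =>
    ⟨Ideal.map f (MvPolynomial.vanishingIdeal K (c i)), by
      have := vanishing_prime _ (hc i).2.1
      exact Ideal.map_isPrime_of_surjective hf (hc i).2.2⟩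
  have hanti : StrictAnti P := by
    intro i j hij
    have h1 := hm hij
    refine lt_of_le_of_ne ?_ ?_
    · change Ideal.map f _ ≤ Ideal.map f _
      exact Ideal.map_mono (MvPolynomial.vanishingIdeal_anti_mono h1.le)
    · intro h
      have h2 : Ideal.map f (MvPolynomial.vanishingIdeal K (c j)) =
        Ideal.map f (MvPolynomial.vanishingIdeal K (c i)) := congrArg PrimeSpectrum.asIdeal h
      have h3 := congrArg (Ideal.comap f) h2
      rw [hcm, hcm] at h3
      have h4 := congrArg (MvPolynomial.zeroLocus K) h3
      rw [zeroLocus_vanishing _ (hc i).1, zeroLocus_vanishing _ (hc j).1] at h4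
      exact h1.ne h4.symm
  let s : LTSeries (PrimeSpectrum B) := LTSeries.mk m (fun i => P i.rev)
    (fun i j hij => hanti (Fin.rev_lt_rev.2 hij))
  exact Order.LTSeries.length_le_krullDim s

lemma chain_exists [IsAlgClosed K] {n : ℕ} {B : Type} [CommRing B]
    (f : MvPolynomial (Fin n) K →+* B) (hf : Function.Surjective f) (s : LTSeries (PrimeSpectrum B)) :
    ∃ c : Fin (s.length + 1) → Set (Fin n → K), (∀ i, ZarClosed K n (c i) ∧ IrredSet K n (c i) ∧
      c i ⊆ MvPolynomial.zeroLocus K (RingHom.ker f)) ∧ StrictMono c := by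
  let Q : Fin (s.length + 1) → Ideal (MvPolynomial (Fin n) K) := fun i =>
    (s i.rev).asIdeal.comap f
  have hQ : ∀ i, (Q i).IsPrime := fun i => Ideal.comap_isPrime f _
  refine ⟨fun i => MvPolynomial.zeroLocus K (Q i), fun i =>
    ⟨zarClosed_zeroLocus _, irred_zeroLocus _ (hQ i), MvPolynomial.zeroLocus_anti_mono ?_⟩, ?_⟩
  · intro a ha
    change f a ∈ (s i.rev).asIdeal
    rw [RingHom.mem_ker.1 ha]
    exact Ideal.zero_mem _
  · intro i j hij
    have hlt : s j.rev < s i.rev := s.strictMono (Fin.rev_lt_rev.2 hij)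
    refine lt_of_le_of_ne (MvPolynomial.zeroLocus_anti_mono (Ideal.comap_mono hlt.le)) ?_
    intro h
    have h1 := congrArg (MvPolynomial.vanishingIdeal K) h
    have := hQ i
    have := hQ j
    rw [MvPolynomial.IsPrime.vanishingIdeal_zeroLocus,
      MvPolynomial.IsPrime.vanishingIdeal_zeroLocus] at h1
    have h2 := Ideal.comap_injective_of_surjective f hf h1
    exact hlt.ne (PrimeSpectrum.ext h2.symm)

def chainSet (K : Type) [Field K] (n : ℕ) (S : Set (Fin n → K)) : Set ℕ :=
  {m : ℕ | ∃ c : Fin (m + 1) → Set (Fin n → K),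
    (∀ i, ZarClosed K n (c i) ∧ IrredSet K n (c i) ∧ c i ⊆ S) ∧ StrictMono c}

lemma chainSet_bdd {n : ℕ} (S : Set (Fin n → K)) : BddAbove (chainSet K n S) := by
  refine ⟨n, ?_⟩
  rintro m ⟨c, hc, hm⟩
  have := chain_le (RingHom.id (MvPolynomial (Fin n) K)) Function.surjective_id c
    (fun i => ⟨(hc i).1, (hc i).2.1, by
      intro a ha
      have : a = 0 := RingHom.mem_ker.1 ha
      rw [this]
      exact Ideal.zero_mem _⟩) hm
  rw [mv_ringKrullDim] at this
  exact_mod_cast this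

lemma zdim_mono {n : ℕ} {S T : Set (Fin n → K)} (h : S ⊆ T) :
    zdim K n S ≤ zdim K n T := by
  change sSup (chainSet K n S) ≤ sSup (chainSet K n T)
  refine csSup_le_csSup' (chainSet_bdd T) ?_
  rintro m ⟨c, hc, hm⟩
  exact ⟨c, fun i => ⟨(hc i).1, (hc i).2.1, (hc i).2.2.trans h⟩, hm⟩

lemma zdim_eq [IsAlgClosed K] {n d : ℕ} (Z : Set (Fin n → K)) (hZ : ZarClosed K n Z)
    {A : Type} [CommRing A] [IsDomain A] [Algebra K A] (f : MvPolynomial (Fin n) K →ₐ[K] A)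
    (hf : Function.Surjective f) (hker : RingHom.ker f = MvPolynomial.vanishingIdeal K Z)
    (y : Fin d → A) (hy : AlgebraicIndependent K y)
    (hIntegral : (MvPolynomial.aeval y : MvPolynomial (Fin d) K →ₐ[K] A).toRingHom.IsIntegral) :
    zdim K n Z = d := by
  change sSup (chainSet K n Z) = d
  have hker' : RingHom.ker f.toRingHom = MvPolynomial.vanishingIdeal K Z := hker
  have hft : Algebra.FiniteType K A := Algebra.FiniteType.of_surjective f hf
  have hN : IsNoetherianRing A := Algebra.FiniteType.isNoetherianRing K A
  apply IsGreatest.csSup_eq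
  constructor
  · obtain ⟨M, hM⟩ := Ideal.exists_maximal A
    have hh := height_ge y hy hIntegral M hM
    have := hM.isPrime
    have e : M.height = Order.height (⟨M, this⟩ : PrimeSpectrum A) :=
      PrimeSpectrum.height_eq_orderHeight ⟨M, this⟩
    rw [e] at hh
    obtain ⟨s, -, hs⟩ := Order.exists_series_of_le_height _ hh
    obtain ⟨c, hc, hm⟩ := chain_exists f.toRingHom hf s
    rw [hker', zeroLocus_vanishing Z hZ] at hc
    rw [← hs]
    exact ⟨c, hc, hm⟩
  · rintro m ⟨c, hc, hm⟩
    have h1 := chain_le f.toRingHom hf c (fun i => ⟨(hc i).1, (hc i).2.1, by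
      rw [hker']
      exact MvPolynomial.vanishingIdeal_anti_mono (hc i).2.2⟩) hm
    have h2 := h1.trans (ringKrullDim_le_of_int y hIntegral)
    exact_mod_cast h2

lemma pts_eq {n : ℕ} (Z : Set (Fin n → K)) (hZ : ZarClosed K n Z)
    {A : Type} [CommRing A] [Algebra K A] (f : MvPolynomial (Fin n) K →ₐ[K] A)
    (hf : Function.Surjective f) (hker : RingHom.ker f = MvPolynomial.vanishingIdeal K Z) :
    Pts K (fun i => f (MvPolynomial.X i)) = Z := by
  apply Set.eq_of_subset_of_subset
  · rintro v ⟨φ, hφ⟩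
    rw [← zeroLocus_vanishing Z hZ, ← hker]
    intro g hg
    have h1 : φ (f g) = MvPolynomial.aeval v g := by
      have : φ.comp f = MvPolynomial.aeval v := by
        apply MvPolynomial.algHom_ext
        intro i
        rw [MvPolynomial.aeval_X]
        exact hφ i
      rw [← this]; rfl
    rw [← h1, RingHom.mem_ker.1 hg, map_zero]
  · intro v hv
    refine ⟨AlgHom.liftOfSurjective f hf (MvPolynomial.aeval v) ?_, fun i => ?_⟩
    · intro g hg
      have : g ∈ MvPolynomial.vanishingIdeal K Z := by rw [← hker]; exact hg
      exact this v hv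
    · exact (AlgHom.liftOfSurjective_apply f hf (MvPolynomial.aeval v) _ (MvPolynomial.X i)).trans
        (MvPolynomial.aeval_X v i)

theorem irred_bound [IsAlgClosed K] (p : ℕ) [Fact p.Prime] [CharP K p] (k : ℕ) (hk : k ≠ 0)
    {n : ℕ} (Z : Set (Fin n → K)) (hZ : ZarClosed K n Z) (hirr : IrredSet K n Z)
    (S : Set (Fin n → K)) (hSZ : S ⊆ Z) (hS : ∀ v ∈ S, ∀ i, v i ^ (p ^ k) = v i) (hfin : S.Finite) :
    S.ncard ≤ zdeg K n Z * (p ^ k) ^ zdim K n Z := by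
  have hp := vanishing_prime Z hirr
  let I := MvPolynomial.vanishingIdeal K Z
  let f := Ideal.Quotient.mkₐ K I
  have hf : Function.Surjective f := Ideal.Quotient.mkₐ_surjective K I
  have hker : RingHom.ker f = MvPolynomial.vanishingIdeal K Z := Ideal.Quotient.mkₐ_ker K I
  let x : Fin n → MvPolynomial (Fin n) K ⧸ I := fun i => f (MvPolynomial.X i)
  have hx : Algebra.adjoin K (Set.range x) = ⊤ :=
    adjoin_map_top f hf MvPolynomial.X MvPolynomial.adjoin_range_X
  have hpts : Pts K x = Z := pts_eq Z hZ f hf hker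
  obtain ⟨d, y, hy, hspan, hred, hIntegral, e, c, hub, b, φ, hφ, hb⟩ := noether_data p x hx
  have hdim : zdim K n Z = d := zdim_eq Z hZ f hf hker y hy hIntegral
  have hdeg : e ≤ zdeg K n Z := by
    obtain ⟨L, hL, hLf, hLe⟩ := deg_ge x hx y hy hspan hred e b φ hφ hb
    rw [hpts] at hLf hLe
    refine hLe.trans (le_csSup ⟨e, ?_⟩ ⟨L, by rw [hdim]; exact hL, hLf, rfl⟩)
    rintro m ⟨L', hL', hLf', rfl⟩
    rw [hdim] at hL'
    have := deg_le x hx y hy hspan hIntegral e c hub L' hL'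
    rw [hpts] at this
    exact this hLf'
  obtain ⟨ψ, hψ, hψS⟩ := exists_homs_of_finite x S (by rw [hpts]; exact hSZ) hfin
  have h1 := count_q x hx y hy hspan hred hIntegral e c hub p k hk _ ψ hψ (fun j i => hS _ (hψS j) i)
  rw [hdim]
  exact h1.trans (Nat.mul_le_mul_right _ hdeg)

end Dim

end PtBound

/-- Lemma 2.1. Let `X ⊆ 𝔸^n` be an affine variety over `𝔽_q` of
dimension `r` and degree `δ` (the degree being the sum of the degrees of its
irreducible components).  Then `#X(𝔽_q) ≤ δ q^r`. -/
theorem statement0 (n r δ u : ℕ) (Fq : Type) [Field Fq] [Fintype Fq]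
    (X : Set (Fin n → AlgebraicClosure Fq)) (hX : ZarClosed (AlgebraicClosure Fq) n X)
    (Z : Fin u → Set (Fin n → AlgebraicClosure Fq))
    (hZcl : ∀ i, ZarClosed (AlgebraicClosure Fq) n (Z i))
    (hZirr : ∀ i, IrredSet (AlgebraicClosure Fq) n (Z i))
    (hZinj : Function.Injective Z)
    (hZmax : ∀ (i : Fin u) (S : Set (Fin n → AlgebraicClosure Fq)),
      ZarClosed (AlgebraicClosure Fq) n S → IrredSet (AlgebraicClosure Fq) n S →
      S ⊆ X → Z i ⊆ S → S = Z i)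
    (hcover : X = ⋃ i, Z i)
    (hdim : zdim (AlgebraicClosure Fq) n X = r)
    (hdeg : δ = ∑ i, zdeg (AlgebraicClosure Fq) n (Z i)) :
    Nat.card {x : Fin n → Fq //
        (fun i => algebraMap Fq (AlgebraicClosure Fq) (x i)) ∈ X}
      ≤ δ * Fintype.card Fq ^ r := by
  obtain ⟨p, hp⟩ := CharP.exists Fq
  have hpp : p.Prime := (CharP.char_is_prime_or_zero Fq p).resolve_right
    (CharP.char_ne_zero_of_finite Fq p)
  have : Fact p.Prime := ⟨hpp⟩
  obtain ⟨k, -, hcard⟩ := FiniteField.card Fq p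
  have : CharP (AlgebraicClosure Fq) p :=
    charP_of_injective_algebraMap (algebraMap Fq (AlgebraicClosure Fq)).injective p
  let ι : (Fin n → Fq) → (Fin n → AlgebraicClosure Fq) :=
    fun x i => algebraMap Fq (AlgebraicClosure Fq) (x i)
  have hι : Function.Injective ι := by
    intro a b h
    funext i
    exact (algebraMap Fq (AlgebraicClosure Fq)).injective (congrFun h i)
  have hone : ∀ i, (ι ⁻¹' Z i).ncard ≤ zdeg (AlgebraicClosure Fq) n (Z i) * Fintype.card Fq ^ r := by
    intro i
    have h1 := PtBound.irred_bound p (k : ℕ) k.ne_zero (Z i) (hZcl i) (hZirr i) (ι '' (ι ⁻¹' Z i))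
      (Set.image_preimage_subset ι (Z i)) (by
        rintro _ ⟨a, -, rfl⟩ j
        change algebraMap Fq (AlgebraicClosure Fq) (a j) ^ _ = algebraMap Fq (AlgebraicClosure Fq) (a j)
        rw [← map_pow, ← hcard, FiniteField.pow_card]) (Set.toFinite _)
    rw [Set.ncard_image_of_injective _ hι, ← hcard] at h1
    refine h1.trans (Nat.mul_le_mul_left _ (Nat.pow_le_pow_right Fintype.card_pos ?_))
    rw [← hdim]
    refine PtBound.zdim_mono ?_
    rw [hcover]
    exact Set.subset_iUnion Z i
  have h2 : Nat.card {x : Fin n → Fq //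
        (fun i => algebraMap Fq (AlgebraicClosure Fq) (x i)) ∈ X} = (ι ⁻¹' X).ncard := rfl
  rw [h2, hdeg, Finset.sum_mul, hcover, Set.preimage_iUnion]
  refine le_trans ?_ (Finset.sum_le_sum fun i _ => hone i)
  rw [← Set.biUnion_univ, ← Finset.coe_univ]
  exact Finset.set_ncard_biUnion_le Finset.univ (fun i => ι ⁻¹' Z i)
end
end

section
/- Let f_1,…,f_R be degree-d forms over 𝔽_q (char(𝔽_q) > d) cutting out a smooth complete intersection in ℙ^{n−1}. Let m ∈ 𝔽_q[t] be monic and b ∈ 𝔽_q[t]^n with gcd(b,m) = 1 and f_i(b) ≡ 0 mod m for all i. Then the number N(m^d) of y ∈ 𝔽_q[t]^n with |y| < |m^d| and f_i(my + b) ≡ 0 mod m^d for all i satisfies N(m^d) = |m|^{R + d(n−R)}. -/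
open scoped Classical NNReal
open Polynomial MeasureTheory

noncomputable section

open MvPolynomial in
theorem taylor {F A : Type*} [Field F] [CommRing A] [Algebra F A] {n : ℕ} (x z : Fin n → A) (h : A) (f : MvPolynomial (Fin n) F) :
    ∃ c, aeval (fun i => x i + h * z i) f = aeval x f + h * ∑ i, z i * aeval x (pderiv i f) + h^2 * c := by
  induction f using MvPolynomial.induction_on with
  | C a => exact ⟨0, by simp⟩
  | add p q hp hq =>
    obtain ⟨c, hc⟩ := hp
    obtain ⟨c', hc'⟩ := hq
    refine ⟨c + c', ?_⟩
    simp only [map_add, hc, hc', mul_add, Finset.sum_add_distrib]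
    ring
  | mul_X p j hp =>
    obtain ⟨c, hc⟩ := hp
    refine ⟨(∑ i, z i * aeval x (pderiv i p)) * z j + c * (x j + h * z j), ?_⟩
    have : ∑ i, z i * aeval x (pderiv i (p * X j)) = (∑ i, z i * aeval x (pderiv i p)) * x j + z j * aeval x p := by
      simp only [Derivation.leibniz, pderiv_X, smul_eq_mul, map_add, map_mul, MvPolynomial.aeval_X, mul_add, Finset.sum_add_distrib, Finset.sum_mul]
      rw [add_comm]
      congr 1
      · exact Finset.sum_congr rfl fun i _ => by ring
      · rw [Finset.sum_eq_single j]
        · simp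
        · intro i _ hi; simp [hi.symm]
        · simp
    rw [this, map_mul, hc]
    simp only [MvPolynomial.aeval_X, map_mul]
    ring

theorem exists_right_inv {Q : Type*} [CommRing Q] {n R : ℕ} (J : Matrix (Fin R) (Fin n) Q)
    (h : ∀ P : Ideal Q, P.IsMaximal → ∃ B : Matrix (Fin n) (Fin R) (Q ⧸ P), J.map (Ideal.Quotient.mk P) * B = 1) :
    ∃ B : Matrix (Fin n) (Fin R) Q, J * B = 1 := by
  let S : Ideal Q :=
    { carrier := {g | ∃ B : Matrix (Fin n) (Fin R) Q, J * B = g • (1 : Matrix (Fin R) (Fin R) Q)}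
      zero_mem' := ⟨0, by simp⟩
      add_mem' := by
        rintro a b ⟨B, hB⟩ ⟨C, hC⟩
        exact ⟨B + C, by rw [Matrix.mul_add, hB, hC, add_smul]⟩
      smul_mem' := by
        rintro c a ⟨B, hB⟩
        exact ⟨c • B, by rw [Matrix.mul_smul, hB, smul_eq_mul, mul_smul]⟩ }
  by_cases hS : S = ⊤
  · have : (1 : Q) ∈ S := by rw [hS]; trivial
    obtain ⟨B, hB⟩ := this
    exact ⟨B, by simpa using hB⟩
  · exfalso
    obtain ⟨P, hP, hSP⟩ := Ideal.exists_le_maximal S hS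
    obtain ⟨B, hB⟩ := h P hP
    choose g hg using fun i j => Ideal.Quotient.mk_surjective (B i j)
    have hB' : (Matrix.of g).map (Ideal.Quotient.mk P) = B := by
      ext i j; exact hg i j
    have hdet : (J * Matrix.of g).det ∈ S :=
      ⟨Matrix.of g * (J * Matrix.of g).adjugate, by rw [← Matrix.mul_assoc, Matrix.mul_adjugate]⟩
    have h0 := Ideal.Quotient.eq_zero_iff_mem.2 (hSP hdet)
    rw [RingHom.map_det, RingHom.mapMatrix_apply, Matrix.map_mul, hB', hB, Matrix.det_one] at h0
    have := Ideal.Quotient.nontrivial_iff.2 hP.ne_top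
    exact one_ne_zero h0

theorem rinv_of_rank {k L : Type*} [Field k] [Field L] (φ : k →+* L) {n R : ℕ} (J : Matrix (Fin R) (Fin n) k)
    (h : (J.map φ).rank = R) : ∃ B : Matrix (Fin n) (Fin R) k, J * B = 1 := by
  rw [← Matrix.mulVec_surjective_iff_exists_right_inverse]
  have h1 : LinearIndependent L (J.map φ).row := by
    rw [linearIndependent_iff_card_eq_finrank_span, Set.finrank, ← Matrix.rank_eq_finrank_span_row, h]; simp
  have h2 : LinearIndependent k J.row := by
    rw [← Matrix.vecMul_injective_iff] at h1 ⊢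
    intro v w hvw
    have : (φ ∘ v) = φ ∘ w := by
      apply h1
      dsimp only at hvw ⊢
      ext i
      have := congrArg φ (congrFun hvw i)
      simpa [Matrix.vecMul, dotProduct] using this
    ext i
    exact φ.injective (congrFun this i)
  have h3 := h2.rank_matrix
  rw [Matrix.rank] at h3
  have := Submodule.eq_top_of_finrank_eq (S := LinearMap.range J.mulVecLin) (by rw [h3]; simp)
  exact LinearMap.range_eq_top.1 this

theorem card_degLT (F : Type) [Field F] [Fintype F] (n D : ℕ) :
    Finite {y : Fin n → F[X] // ∀ i, (y i).degree < (D : WithBot ℕ)} ∧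
    Nat.card {y : Fin n → F[X] // ∀ i, (y i).degree < (D : WithBot ℕ)} = Fintype.card F ^ (n * D) := by
  let e : {y : Fin n → F[X] // ∀ i, (y i).degree < (D : WithBot ℕ)} ≃ (Fin n → Fin D → F) :=
    { toFun := fun y i => degreeLTEquiv F D ⟨y.1 i, mem_degreeLT.2 (y.2 i)⟩
      invFun := fun v => ⟨fun i => ((degreeLTEquiv F D).symm (v i)).1, fun i => mem_degreeLT.1 ((degreeLTEquiv F D).symm (v i)).2⟩
      left_inv := fun y => by
        ext1; funext i; simp
      right_inv := fun v => by
        funext i; simp }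
  refine ⟨Finite.of_equiv _ e.symm, ?_⟩
  rw [Nat.card_congr e, Nat.card_eq_fintype_card]
  simp [← pow_mul, mul_comm]

theorem finite_degLT (F : Type) [Field F] [Fintype F] (n D : ℕ) (P : (Fin n → F[X]) → Prop) :
    Finite {y : Fin n → F[X] // (∀ i, (y i).degree < (D : WithBot ℕ)) ∧ P y} := by
  have := (card_degLT F n D).1
  exact Finite.of_injective (β := {y : Fin n → F[X] // ∀ i, (y i).degree < (D : WithBot ℕ)})
    (fun y => ⟨y.1, y.2.1⟩) (fun a b h => by ext1; simpa using h)

theorem split_count (F : Type) [Field F] [Fintype F] (n j : ℕ) (m : F[X]) (hm : m.Monic)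
    (P Q : (Fin n → F[X]) → Prop) (P' : (Fin n → F[X]) → (Fin n → F[X]) → Prop)
    (h : ∀ y z, P (fun i => y i + m ^ j * z i) ↔ Q y ∧ P' y z) (N : ℕ)
    (hN : ∀ y, Q y → Nat.card {z : Fin n → F[X] // (∀ i, (z i).degree < (m.natDegree : WithBot ℕ)) ∧ P' y z} = N) :
    Nat.card {y : Fin n → F[X] // (∀ i, (y i).degree < (((j + 1) * m.natDegree : ℕ) : WithBot ℕ)) ∧ P y} =
      Nat.card {y : Fin n → F[X] // (∀ i, (y i).degree < ((j * m.natDegree : ℕ) : WithBot ℕ)) ∧ Q y} * N := by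
  have hmj : (m ^ j).Monic := hm.pow j
  have hdeg : (m ^ j).degree = ((j * m.natDegree : ℕ) : WithBot ℕ) := by
    rw [degree_eq_natDegree hmj.ne_zero, hm.natDegree_pow]
  have hmod : ∀ y : F[X], (y %ₘ m ^ j).degree < ((j * m.natDegree : ℕ) : WithBot ℕ) := fun y => by
    rw [← hdeg]; exact degree_modByMonic_lt _ hmj
  have hdiv : ∀ y : F[X], y.degree < (((j + 1) * m.natDegree : ℕ) : WithBot ℕ) →
      (y /ₘ m ^ j).degree < (m.natDegree : WithBot ℕ) := fun y hy => by
    by_cases h0 : y /ₘ m ^ j = 0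
    · rw [h0, degree_zero]; exact WithBot.bot_lt_coe _
    have hy0 : y ≠ 0 := by rintro rfl; simp at h0
    rw [degree_eq_natDegree h0]
    rw [degree_eq_natDegree hy0] at hy
    have hle : (m ^ j).degree ≤ y.degree := by
      by_contra hc
      exact h0 ((divByMonic_eq_zero_iff hmj).2 (not_le.1 hc))
    rw [hdeg, degree_eq_natDegree hy0] at hle
    have h1 := natDegree_divByMonic y hmj
    rw [hm.natDegree_pow] at h1
    norm_cast at *
    rw [add_mul] at hy
    omega
  have hadd : ∀ y z : F[X], y.degree < ((j * m.natDegree : ℕ) : WithBot ℕ) →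
      z.degree < (m.natDegree : WithBot ℕ) →
      (y + m ^ j * z).degree < (((j + 1) * m.natDegree : ℕ) : WithBot ℕ) := fun y z hy hz => by
    refine lt_of_le_of_lt (degree_add_le _ _) (max_lt (hy.trans_le ?_) ?_)
    · exact_mod_cast Nat.mul_le_mul_right _ (Nat.le_succ j)
    · by_cases hz0 : z = 0
      · simp only [hz0, mul_zero, degree_zero]; exact WithBot.bot_lt_coe _
      rw [degree_mul, hdeg]
      rw [degree_eq_natDegree hz0] at hz ⊢
      norm_cast at *
      rw [add_mul]; omega
  let e : {y : Fin n → F[X] // (∀ i, (y i).degree < (((j + 1) * m.natDegree : ℕ) : WithBot ℕ)) ∧ P y} ≃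
     Σ y : {y : Fin n → F[X] // (∀ i, (y i).degree < ((j * m.natDegree : ℕ) : WithBot ℕ)) ∧ Q y},
       {z : Fin n → F[X] // (∀ i, (z i).degree < (m.natDegree : WithBot ℕ)) ∧ P' y.1 z} :=
    { toFun := fun y =>
        have H := (h (fun i => y.1 i %ₘ m ^ j) (fun i => y.1 i /ₘ m ^ j)).1 (by
          simp only [modByMonic_add_div]; exact y.2.2)
        ⟨⟨fun i => y.1 i %ₘ m ^ j, fun i => hmod _, H.1⟩,
         ⟨fun i => y.1 i /ₘ m ^ j, fun i => hdiv _ (y.2.1 i), H.2⟩⟩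
      invFun := fun s => ⟨fun i => s.1.1 i + m ^ j * s.2.1 i, fun i => hadd _ _ (s.1.2.1 i) (s.2.2.1 i),
        (h _ _).2 ⟨s.1.2.2, s.2.2.2⟩⟩
      left_inv := fun y => by
        ext1; funext i; exact modByMonic_add_div _ _
      right_inv := by
        rintro ⟨⟨y, hy, hq⟩, ⟨z, hz, hp⟩⟩
        have hu := fun i => div_modByMonic_unique (f := y i + m ^ j * z i) (z i) (y i) hmj ⟨rfl, by rw [hdeg]; exact hy i⟩
        have h1 : (fun i => (y i + m ^ j * z i) %ₘ m ^ j) = y := funext fun i => (hu i).2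
        have h2 : (fun i => (y i + m ^ j * z i) /ₘ m ^ j) = z := funext fun i => (hu i).1
        simp only [h2]
        congr!  }
  have f1 := finite_degLT F n (j * m.natDegree) Q
  have f2 := fun y => finite_degLT F n m.natDegree (P' y)
  have := Fintype.ofFinite {y : Fin n → F[X] // (∀ i, (y i).degree < ((j * m.natDegree : ℕ) : WithBot ℕ)) ∧ Q y}
  rw [Nat.card_congr e, Nat.card_sigma, Finset.sum_congr rfl (fun y _ => hN y.1 y.2.2)]
  rw [Finset.sum_const, smul_eq_mul, Finset.card_univ, Nat.card_eq_fintype_card]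

theorem count_fiber (F : Type) [Field F] [Fintype F] (n R : ℕ) (hRn : R ≤ n) (m : F[X]) (hm : m.Monic)
    (J : Matrix (Fin R) (Fin n) F[X]) (B : Matrix (Fin n) (Fin R) F[X])
    (hB : ∀ w k, m ∣ (J.mulVec (B.mulVec w)) k - w k) (c : Fin R → F[X]) :
    Nat.card {z : Fin n → F[X] // (∀ i, (z i).degree < (m.natDegree : WithBot ℕ)) ∧ ∀ k, m ∣ c k + J.mulVec z k} =
     Fintype.card F ^ ((n - R) * m.natDegree) := by
  have hdm : m.degree = m.natDegree := degree_eq_natDegree hm.ne_zero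
  have hmod : ∀ y : F[X], (y %ₘ m).degree < (m.natDegree : WithBot ℕ) := fun y => by
    rw [← hdm]; exact degree_modByMonic_lt _ hm
  let V (n : ℕ) : AddSubgroup (Fin n → F[X]) :=
    { carrier := {z | ∀ i, (z i).degree < (m.natDegree : WithBot ℕ)}
      zero_mem' := fun i => by simp
      add_mem' := fun {a b} ha hb i => lt_of_le_of_lt (degree_add_le _ _) (max_lt (ha i) (hb i))
      neg_mem' := fun {a} ha i => by simpa using ha i }
  have hV : ∀ n, Finite (V n) ∧ Nat.card (V n) = Fintype.card F ^ (n * m.natDegree) :=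
    fun n => card_degLT F n m.natDegree
  let φ : V n →+ V R :=
    { toFun := fun z => ⟨fun k => (J.mulVec z.1 k) %ₘ m, fun k => hmod _⟩
      map_zero' := by ext1; funext k; simp
      map_add' := fun a b => by
        ext1; funext k; simp [Matrix.mulVec_add, add_modByMonic] }
  have key : ∀ (z : V n) (w : Fin R → F[X]), (∀ k, (φ z).1 k = w k %ₘ m) ↔ ∀ k, m ∣ J.mulVec z.1 k - w k := by
    intro z w
    refine forall_congr' fun k => ?_
    rw [← modByMonic_eq_zero_iff_dvd hm, sub_modByMonic, sub_eq_zero]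
    rfl
  have hsurj : Function.Surjective φ := by
    intro w
    refine ⟨⟨fun i => B.mulVec w.1 i %ₘ m, fun i => hmod _⟩, ?_⟩
    ext1; funext k
    have hw : w.1 k %ₘ m = w.1 k := (modByMonic_eq_self_iff hm).2 (by rw [hdm]; exact w.2 k)
    rw [← hw]
    revert k
    intro k hw
    refine (key _ w.1).2 (fun k => ?_) k
    have h1 : m ∣ J.mulVec (fun i => B.mulVec w.1 i %ₘ m) k - J.mulVec (B.mulVec w.1) k := by
      rw [← Pi.sub_apply, ← Matrix.mulVec_sub]
      simp only [Matrix.mulVec, dotProduct]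
      refine Finset.dvd_sum fun i _ => ?_
      refine Dvd.dvd.mul_left ?_ _
      change m ∣ B.mulVec w.1 i %ₘ m - B.mulVec w.1 i
      refine ⟨-(B.mulVec w.1 i /ₘ m), ?_⟩
      have := modByMonic_add_div (B.mulVec w.1 i) m
      linear_combination this
    have := dvd_add h1 (hB w.1 k)
    simpa using this
  have f1 := (hV n).1
  have f2 := (hV R).1
  -- card of fibers
  have hfib : ∀ w : V R, Nat.card {z : V n // φ z = w} * Nat.card (V R) = Nat.card (V n) := by
    intro w
    have := Fintype.ofFinite (V n)
    have := Fintype.ofFinite (V R)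
    have h1 : ∀ w', Nat.card {z : V n // φ z = w'} = Nat.card {z : V n // φ z = w} := by
      intro w'
      rw [Nat.card_eq_fintype_card, Nat.card_eq_fintype_card, Fintype.card_subtype, Fintype.card_subtype]
      exact AddMonoidHom.card_fiber_eq_of_mem_range φ (hsurj w') (hsurj w)
    rw [Nat.card_congr (Equiv.sigmaFiberEquiv φ).symm, Nat.card_sigma, Finset.sum_congr rfl fun w' _ => h1 w']
    simp [mul_comm]
  have h2 := hfib ⟨fun k => (-c k) %ₘ m, fun k => hmod _⟩
  rw [(hV n).2, (hV R).2] at h2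
  have h3 : Nat.card {z : Fin n → F[X] // (∀ i, (z i).degree < (m.natDegree : WithBot ℕ)) ∧ ∀ k, m ∣ c k + J.mulVec z k} =
      Nat.card {z : V n // φ z = ⟨fun k => (-c k) %ₘ m, fun k => hmod _⟩} := by
    refine Nat.card_congr (Equiv.trans (Equiv.subtypeSubtypeEquivSubtypeInter (fun z => z ∈ V n) (fun z => ∀ k, m ∣ c k + J.mulVec z k)).symm
      (Equiv.subtypeEquivRight fun z => ?_))
    rw [Subtype.ext_iff, funext_iff]
    refine Iff.trans ?_ (key z (fun k => - c k)).symm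
    simp [add_comm]
  rw [h3]
  have hpos : 0 < Fintype.card F ^ (R * m.natDegree) := pow_pos Fintype.card_pos _
  apply Nat.eq_of_mul_eq_mul_right hpos
  rw [h2, ← pow_add, ← add_mul, Nat.sub_add_cancel hRn]

theorem jac_inv (F : Type) [Field F] [Fintype F] (n R : ℕ) 
    (f : Fin R → MvPolynomial (Fin n) F)
    (hsm : ∀ x : Fin n → AlgebraicClosure F, x ≠ 0 → (∀ k, MvPolynomial.aeval x (f k) = 0) →
      Matrix.rank (Matrix.of fun (k : Fin R) (i : Fin n) =>
        MvPolynomial.aeval x (MvPolynomial.pderiv i (f k))) = R)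
    (m : Polynomial F) (hmon : m.Monic)
    (b : Fin n → Polynomial F)
    (hcop : ∀ g : Polynomial F, g ∣ m → (∀ i, g ∣ b i) → IsUnit g)
    (hfb : ∀ k, m ∣ MvPolynomial.aeval b (f k)) :
    ∃ B : Matrix (Fin n) (Fin R) F[X], ∀ w k, m ∣ 
      ((Matrix.of fun k i => MvPolynomial.aeval b (MvPolynomial.pderiv i (f k))).mulVec (B.mulVec w)) k - w k := by
  set J : Matrix (Fin R) (Fin n) F[X] := Matrix.of fun k i => MvPolynomial.aeval b (MvPolynomial.pderiv i (f k)) with hJ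
  let I := Ideal.span {m}
  obtain ⟨B, hB⟩ := exists_right_inv (J.map (Ideal.Quotient.mk I)) (by
    intro P hP
    letI := Ideal.Quotient.field P
    have : Module.Finite F (F[X] ⧸ I) := hmon.finite_quotient
    have : Module.Finite F ((F[X] ⧸ I) ⧸ P) := Module.Finite.of_surjective (Ideal.Quotient.mkₐ F P).toLinearMap (Ideal.Quotient.mkₐ_surjective F P)
    have : Algebra.IsAlgebraic F ((F[X] ⧸ I) ⧸ P) := inferInstance
    let φ : ((F[X] ⧸ I) ⧸ P) →ₐ[F] AlgebraicClosure F := IsAlgClosed.lift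
    apply rinv_of_rank φ.toRingHom
    let ψ : F[X] →ₐ[F] AlgebraicClosure F := φ.comp ((Ideal.Quotient.mkₐ F P).comp (Ideal.Quotient.mkₐ F I))
    have hψm : ψ m = 0 := by
      have : Ideal.Quotient.mk I m = 0 := Ideal.Quotient.eq_zero_iff_mem.2 (Ideal.mem_span_singleton_self m)
      simp [ψ, this]
    have hψ : ∀ g : MvPolynomial (Fin n) F, ψ (MvPolynomial.aeval b g) = MvPolynomial.aeval (fun i => ψ (b i)) g := by
      intro g
      rw [← AlgHom.comp_apply, MvPolynomial.comp_aeval]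
    have hr := hsm (fun i => ψ (b i)) ?_ ?_
    · convert hr using 2
      ext k i
      simp only [Matrix.map_apply, Matrix.of_apply, ← hψ, hJ]
      rfl
    · intro h0
      have hmax : (RingHom.ker ψ) ≠ ⊤ := RingHom.ker_ne_top _
      obtain ⟨g, hg⟩ := IsPrincipalIdealRing.principal (RingHom.ker ψ)
      have hg' : RingHom.ker ψ = Ideal.span {g} := hg
      have hmem : ∀ a, ψ a = 0 → g ∣ a := fun a ha => by
        rw [← Ideal.mem_span_singleton, ← hg']; exact ha
      have := hcop g (hmem m hψm) (fun i => hmem _ (congrFun h0 i))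
      rw [hg', Ne, Ideal.span_singleton_eq_top] at hmax
      exact hmax this
    · intro k
      rw [← hψ]
      obtain ⟨c, hc⟩ := hfb k
      rw [hc, map_mul, hψm, zero_mul])
  choose g hg using fun i j => Ideal.Quotient.mk_surjective (B i j)
  have hB' : (Matrix.of g).map (Ideal.Quotient.mk I) = B := by
    ext i j; exact hg i j
  refine ⟨Matrix.of g, fun w k => ?_⟩
  rw [← Ideal.mem_span_singleton, ← Ideal.Quotient.eq, Matrix.mulVec_mulVec, RingHom.map_mulVec, Matrix.map_mul]
  rw [hB', hB, Matrix.one_mulVec]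
  rfl

theorem main_aux (F : Type) [Field F] [Fintype F] (n R : ℕ) (hRn : R ≤ n)
    (f : Fin R → MvPolynomial (Fin n) F)
    (hsm : ∀ x : Fin n → AlgebraicClosure F, x ≠ 0 → (∀ k, MvPolynomial.aeval x (f k) = 0) →
      Matrix.rank (Matrix.of fun (k : Fin R) (i : Fin n) =>
        MvPolynomial.aeval x (MvPolynomial.pderiv i (f k))) = R)
    (m : Polynomial F) (hmon : m.Monic)
    (b : Fin n → Polynomial F)
    (hcop : ∀ g : Polynomial F, g ∣ m → (∀ i, g ∣ b i) → IsUnit g)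
    (hfb : ∀ k, m ∣ MvPolynomial.aeval b (f k)) (j : ℕ) :
    Nat.card {y : Fin n → F[X] // (∀ i, (y i).degree < ((j * m.natDegree : ℕ) : WithBot ℕ)) ∧
      ∀ k, m ^ (j + 1) ∣ MvPolynomial.aeval (fun i => m * y i + b i) (f k)} =
     Fintype.card F ^ (j * ((n - R) * m.natDegree)) := by
  obtain ⟨B, hB⟩ := jac_inv F n R f hsm m hmon b hcop hfb
  induction j with
  | zero =>
    rw [zero_mul (_ * _), pow_zero, Nat.card_eq_one_iff_unique]
    refine ⟨⟨fun a c => ?_⟩, ⟨⟨0, by simp, by simpa using hfb⟩⟩⟩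
    have h0 : ∀ a : F[X], a.degree < ((0 * m.natDegree : ℕ) : WithBot ℕ) → a = 0 := by
      intro a ha
      rw [zero_mul, Nat.cast_zero] at ha
      rw [← degree_eq_bot]
      exact Nat.WithBot.lt_zero_iff.1 ha
    ext1; funext i
    rw [h0 _ (a.2.1 i), h0 _ (c.2.1 i)]
  | succ j ih =>
    rw [split_count F n j m hmon _
      (fun y => ∀ k, m ^ (j + 1) ∣ MvPolynomial.aeval (fun i => m * y i + b i) (f k))
      (fun y z => ∀ k, m ∣ (MvPolynomial.aeval (fun i => m * y i + b i) (f k)) / m ^ (j + 1) +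
         (Matrix.of fun k i => MvPolynomial.aeval b (MvPolynomial.pderiv i (f k))).mulVec z k) ?_ _
      (fun y hy => count_fiber F n R hRn m hmon _ B hB _), ih, ← pow_add]
    · congr 1; ring
    · intro y z
      rw [← forall_and]
      refine forall_congr' fun k => ?_
      obtain ⟨c, hc⟩ := taylor (fun i => m * y i + b i) z (m ^ (j + 1)) (f k)
      have hrw : (fun i => m * (y i + m ^ j * z i) + b i) = fun i => (m * y i + b i) + m ^ (j + 1) * z i := by
        funext i; ring
      rw [hrw, hc]
      have hcong : m ∣ (∑ i, z i * MvPolynomial.aeval (fun i => m * y i + b i) (MvPolynomial.pderiv i (f k))) -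
          (Matrix.of fun k i => MvPolynomial.aeval b (MvPolynomial.pderiv i (f k))).mulVec z k := by
        simp only [Matrix.mulVec, dotProduct, Matrix.of_apply, ← Finset.sum_sub_distrib]
        refine Finset.dvd_sum fun i _ => ?_
        obtain ⟨c', hc'⟩ := taylor b y m (MvPolynomial.pderiv i (f k))
        have : (fun i => m * y i + b i) = fun i => b i + m * y i := funext fun i => add_comm _ _
        rw [this, hc']
        exact ⟨z i * (∑ l, y l * MvPolynomial.aeval b (MvPolynomial.pderiv l (MvPolynomial.pderiv i (f k))) + m * c'), by ring⟩
      obtain ⟨c', hc'⟩ := hcong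
      rw [sub_eq_iff_eq_add] at hc'
      rw [hc']
      have hm0 : m ^ (j + 1) ≠ 0 := pow_ne_zero _ hmon.ne_zero
      generalize (Matrix.of fun k i => MvPolynomial.aeval b (MvPolynomial.pderiv i (f k))).mulVec z k = s
      generalize MvPolynomial.aeval (fun i => m * y i + b i) (f k) = a
      have h1 : m ^ (j + 1 + 1) ∣ a + m ^ (j + 1) * (m * c' + s) + (m ^ (j + 1)) ^ 2 * c ↔ m ^ (j + 1 + 1) ∣ a + m ^ (j + 1) * s := by
        have : a + m ^ (j + 1) * (m * c' + s) + (m ^ (j + 1)) ^ 2 * c = 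
          (a + m ^ (j + 1) * s) + m ^ (j + 1 + 1) * (c' + m ^ j * c) := by ring
        rw [this]
        exact dvd_add_left (Dvd.intro _ rfl)
      rw [h1]
      have h2 : ∀ a', m ^ (j + 1 + 1) ∣ m ^ (j + 1) * a' + m ^ (j + 1) * s ↔ m ∣ a' + s := by
        intro a'
        rw [← mul_add, pow_succ, mul_dvd_mul_iff_left hm0]
      constructor
      · intro h
        have h3 : m ^ (j + 1) ∣ a := by
          have := (pow_dvd_pow m (Nat.le_succ (j + 1))).trans h
          exact (dvd_add_left (Dvd.intro _ rfl)).1 this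
        refine ⟨h3, ?_⟩
        rwa [← h2, EuclideanDomain.mul_div_cancel' hm0 h3]
      · rintro ⟨h3, h⟩
        rwa [← h2, EuclideanDomain.mul_div_cancel' hm0 h3] at h

/-- Lemma 3.6 computation: `N(m^d) = |m|^{R + d(n-R)}`. -/
theorem statement9 (Fq : Type) [Field Fq] [Fintype Fq] (p d n R : ℕ)
    [Fact p.Prime] [CharP Fq p] (hd : 2 ≤ d) (hdp : d < p) (hRn : R ≤ n)
    (f : Fin R → MvPolynomial (Fin n) Fq) (hsm : SmoothCI Fq d f)
    (m : Polynomial Fq) (hmon : m.Monic)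
    (b : Fin n → Polynomial Fq)
    (hcop : ∀ g : Polynomial Fq, g ∣ m → (∀ i, g ∣ b i) → IsUnit g)
    (hfb : ∀ k, m ∣ MvPolynomial.aeval b (f k)) :
    Nat.card {y : Fin n → Polynomial Fq //
        (∀ i, (y i).degree < ((d * m.natDegree : ℕ) : WithBot ℕ)) ∧
        ∀ k, m ^ d ∣ MvPolynomial.aeval (fun i => m * y i + b i) (f k)}
      = Fintype.card Fq ^ ((R + d * (n - R)) * m.natDegree) := by
  obtain ⟨j, rfl⟩ : ∃ j, d = j + 1 := ⟨d - 1, by omega⟩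
  rw [split_count Fq n j m hmon _
      (fun y => ∀ k, m ^ (j + 1) ∣ MvPolynomial.aeval (fun i => m * y i + b i) (f k))
      (fun _ _ => True) ?_ (Fintype.card Fq ^ (n * m.natDegree)) ?_,
    main_aux Fq n R hRn f hsm.2.2 m hmon b hcop hfb j, ← pow_add]
  · congr 1
    obtain ⟨s, rfl⟩ := Nat.exists_eq_add_of_le hRn
    rw [Nat.add_sub_cancel_left]
    ring
  · intro y z
    simp only [and_true]
    refine forall_congr' fun k => ?_
    obtain ⟨c, hc⟩ := taylor (fun i => m * y i + b i) z (m ^ (j + 1)) (f k)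
    have hrw : (fun i => m * (y i + m ^ j * z i) + b i) =
        fun i => (m * y i + b i) + m ^ (j + 1) * z i := by
      funext i; ring
    rw [hrw, hc, add_assoc]
    apply dvd_add_left
    rw [pow_two, mul_assoc, ← mul_add]
    exact Dvd.intro _ rfl
  · intro y _
    simp only [and_true]
    exact (card_degLT Fq n m.natDegree).2
end
end
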